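/- arXiv:2408.10661 — 10 statements merged into one kernel-verified Lean document; each statement's English description precedes it below -/
import Mathlib

section
/- Let ε > 0 and let S, C : ℝ × (0, ∞) → ℝ be C² functions with S strictly positive, both satisfying the heat equation ∂_τ S = ε ∂²_x S and ∂_τ C = ε ∂²_x C on ℝ × (0, ∞). Set U = −2ε log S and V = C/S. Then V satisfies the linear transport–diffusion equation ∂_τ V + (∂_x U)(∂_x V) = ε ∂²_x V at every point (x, τ) with x ∈ ℝ, τ > 0. -/
open Real Filter

lemma slice_x_aux (F : ℝ → ℝ → ℝ)
    (hF : ContDiffOn ℝ 2 (fun p : ℝ × ℝ => F p.1 p.2) (Set.univ ×ˢ Set.Ioi 0))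
    (τ : ℝ) (hτ : 0 < τ) : ContDiff ℝ 2 (fun x => F x τ) := by
  have h : ContDiff ℝ 2 (fun x : ℝ => ((x, τ) : ℝ × ℝ)) := by fun_prop
  have h2 := hF.comp (s := Set.univ) h.contDiffOn (fun x _ => ⟨Set.mem_univ _, hτ⟩)
  exact contDiffOn_univ.1 h2

lemma slice_t_aux (F : ℝ → ℝ → ℝ)
    (hF : ContDiffOn ℝ 2 (fun p : ℝ × ℝ => F p.1 p.2) (Set.univ ×ˢ Set.Ioi 0))
    (x τ : ℝ) (hτ : 0 < τ) : DifferentiableAt ℝ (fun t => F x t) τ := by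
  have h : ContDiff ℝ 2 (fun t : ℝ => ((x, t) : ℝ × ℝ)) := by fun_prop
  have h2 := hF.comp (s := Set.Ioi 0) h.contDiffOn (fun t ht => ⟨Set.mem_univ _, ht⟩)
  exact (h2.differentiableOn (by norm_num)).differentiableAt (Ioi_mem_nhds hτ)

/-- **generalized Hopf–Cole transformation.**
If `S, C` are `C²` functions on `ℝ × (0, ∞)` with `S > 0`, both solving the heat equation
`∂_τ S = ε ∂²_x S`, `∂_τ C = ε ∂²_x C`, then with `U = -2ε log S` and `V = C / S`,
the function `V` satisfies `∂_τ V + (∂_x U)(∂_x V) = ε ∂²_x V` on `ℝ × (0, ∞)`. -/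
theorem hopf_cole_transport_diffusion
    (ε : ℝ) (hε : 0 < ε) (S C : ℝ → ℝ → ℝ)
    (hS : ContDiffOn ℝ 2 (fun p : ℝ × ℝ => S p.1 p.2) (Set.univ ×ˢ Set.Ioi 0))
    (hC : ContDiffOn ℝ 2 (fun p : ℝ × ℝ => C p.1 p.2) (Set.univ ×ˢ Set.Ioi 0))
    (hSpos : ∀ x τ, 0 < τ → 0 < S x τ)
    (hheatS : ∀ x τ, 0 < τ →
      deriv (fun σ => S x σ) τ
        = ε * deriv (fun x' => deriv (fun x'' => S x'' τ) x') x)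
    (hheatC : ∀ x τ, 0 < τ →
      deriv (fun σ => C x σ) τ
        = ε * deriv (fun x' => deriv (fun x'' => C x'' τ) x') x) :
    ∀ x τ, 0 < τ →
      deriv (fun σ => C x σ / S x σ) τ
        + (deriv (fun x' => -2 * ε * Real.log (S x' τ)) x)
          * (deriv (fun x' => C x' τ / S x' τ) x)
        = ε * deriv (fun x' => deriv (fun x'' => C x'' τ / S x'' τ) x') x := by
  intro x τ hτ
  have cS := slice_x_aux S hS τ hτ
  have cC := slice_x_aux C hC τ hτ
  have hne : ∀ y, S y τ ≠ 0 := fun y => (hSpos y τ hτ).ne'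
  have dS : ∀ y, HasDerivAt (fun x => S x τ) (deriv (fun x => S x τ) y) y :=
    fun y => (cS.differentiable (by norm_num) y).hasDerivAt
  have dC : ∀ y, HasDerivAt (fun x => C x τ) (deriv (fun x => C x τ) y) y :=
    fun y => (cC.differentiable (by norm_num) y).hasDerivAt
  have ddS : HasDerivAt (deriv (fun x => S x τ)) (deriv (deriv (fun x => S x τ)) x) x :=
    ((cS.differentiable_deriv_two) x).hasDerivAt
  have ddC : HasDerivAt (deriv (fun x => C x τ)) (deriv (deriv (fun x => C x τ)) x) x :=
    ((cC.differentiable_deriv_two) x).hasDerivAt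
  have tS := (slice_t_aux S hS x τ hτ).hasDerivAt
  have tC := (slice_t_aux C hC x τ hτ).hasDerivAt
  have e1 := (tC.fun_div tS (hne x)).deriv
  have e2 := (((dS x).log (hne x)).const_mul (-2 * ε)).deriv
  have e3 : (fun y => deriv (fun x => C x τ / S x τ) y) = fun y =>
      (deriv (fun x => C x τ) y * S y τ - C y τ * deriv (fun x => S x τ) y) / S y τ ^ 2 :=
    funext fun y => ((dC y).fun_div (dS y) (hne y)).deriv
  have e4 := (((ddC.fun_mul (dS x)).fun_sub ((dC x).fun_mul ddS)).fun_div ((dS x).fun_pow 2)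
    (pow_ne_zero 2 (hne x))).deriv
  have e5 := ((dC x).fun_div (dS x) (hne x)).deriv
  have h1 := hheatS x τ hτ
  have h2 := hheatC x τ hτ
  rw [e3, e4, e1, e2, e5, h1, h2]
  have := hne x
  simp only [Nat.cast_ofNat]
  field_simp
  ring
end

section
/- Let u0 ∈ L^∞(ℝ) be measurable, let ε > 0, τ > 0 and x ∈ ℝ. Then ∫_ℝ ((y − x)/τ + u0(y)) · exp(−θ(x, y, τ)/(2ε)) dy = 0. Equivalently, ∫_ℝ ((x − y)/τ) exp(−θ(x, y, τ)/(2ε)) dy = ∫_ℝ u0(y) exp(−θ(x, y, τ)/(2ε)) dy. -/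
open Real Filter MeasureTheory

/-- `θ(x, y, τ) = (x - y)²/(2τ) + ∫_0^y u0(s) ds`. -/
noncomputable def thetaFn (u0 : ℝ → ℝ) (x y τ : ℝ) : ℝ :=
  (x - y) ^ 2 / (2 * τ) + ∫ s in (0:ℝ)..y, u0 s

/-- For bounded measurable `u0`, `ε > 0`, `τ > 0` and `x ∈ ℝ`,
`∫_ℝ ((y - x)/τ + u0(y)) exp(-θ(x,y,τ)/(2ε)) dy = 0`; equivalently
`∫_ℝ ((x - y)/τ) exp(-θ/(2ε)) dy = ∫_ℝ u0(y) exp(-θ/(2ε)) dy`. -/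
theorem integral_derivative_identity
    (u0 : ℝ → ℝ) (hu0m : Measurable u0) (hu0b : ∃ M, ∀ y, |u0 y| ≤ M)
    (ε τ x : ℝ) (hε : 0 < ε) (hτ : 0 < τ) :
    (∫ y : ℝ, ((y - x) / τ + u0 y) * Real.exp (-(thetaFn u0 x y τ) / (2 * ε))) = 0
    ∧ (∫ y : ℝ, ((x - y) / τ) * Real.exp (-(thetaFn u0 x y τ) / (2 * ε)))
      = ∫ y : ℝ, u0 y * Real.exp (-(thetaFn u0 x y τ) / (2 * ε)) := by
  obtain ⟨M, hM⟩ := hu0b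
  have hM0 : 0 ≤ M := (abs_nonneg _).trans (hM 0)
  have hloc : LocallyIntegrable u0 volume := by
    refine (memLp_top_of_bound hu0m.aestronglyMeasurable M
      (Eventually.of_forall fun y => ?_)).locallyIntegrable le_top
    simpa using hM y
  have hii : ∀ a b, IntervalIntegrable u0 volume a b := fun a b =>
    intervalIntegrable_iff.mpr
      ((hloc.integrableOn_isCompact isCompact_uIcc).mono_set Set.uIoc_subset_uIcc)
  have hUlip : LipschitzWith M.toNNReal (fun y => ∫ s in (0:ℝ)..y, u0 s) := by
    refine LipschitzWith.of_dist_le_mul fun a b => ?_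
    rw [Real.dist_eq, Real.dist_eq, intervalIntegral.integral_interval_sub_left (hii _ _) (hii _ _),
      Real.coe_toNNReal _ hM0]
    have := intervalIntegral.norm_integral_le_of_norm_le_const (a := b) (b := a) (f := u0) (C := M)
      (fun y _ => by simpa using hM y)
    simpa using this
  set G : ℝ → ℝ := fun y => Real.exp (-(thetaFn u0 x y τ) / (2 * ε)) with hG
  have hUb : ∀ y, |∫ s in (0:ℝ)..y, u0 s| ≤ M * |y| := by
    intro y
    have := intervalIntegral.norm_integral_le_of_norm_le_const (a := 0) (b := y) (f := u0) (C := M)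
      (fun y _ => by simpa using hM y)
    simpa using this
  have hLL : LocallyLipschitz G := by
    have h2 : ContDiff ℝ 1 (fun p : ℝ × ℝ =>
        Real.exp (-((x - p.1) ^ 2 / (2 * τ) + p.2) / (2 * ε))) := by
      fun_prop
    have h3 := (h2.locallyLipschitz).comp (LocallyLipschitz.id.prodMk hUlip.locallyLipschitz)
    have h4 : G = (fun p : ℝ × ℝ => Real.exp (-((x - p.1) ^ 2 / (2 * τ) + p.2) / (2 * ε))) ∘
        fun y => (id y, ∫ s in (0:ℝ)..y, u0 s) := by
      funext y
      simp only [hG, thetaFn, Function.comp, id]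
    rw [h4]
    exact h3
  have hGc : Continuous G := hLL.continuous
  have hder : ∀ᵐ y, deriv G y = (-1 / (2 * ε)) * (((y - x) / τ + u0 y) * G y) := by
    filter_upwards [LocallyIntegrable.ae_hasDerivAt_integral hloc] with y hy
    have h1 : HasDerivAt (fun y => thetaFn u0 x y τ) ((y - x) / τ + u0 y) y := by
      have := ((((hasDerivAt_id y).const_sub x).pow 2).div_const (2 * τ)).add (hy 0)
      refine this.congr_deriv ?_
      simp
      field_simp
      ring
    have h2 := ((h1.neg).div_const (2 * ε)).exp
    have h3 : HasDerivAt G (G y * (-((y - x) / τ + u0 y) / (2 * ε))) y := h2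
    rw [h3.deriv]
    ring
  set b : ℝ := 1 / (8 * ε * τ) with hb
  have hb0 : 0 < b := by positivity
  set C : ℝ := Real.exp ((M * |x| + M ^ 2 * τ) / (2 * ε)) with hC
  have hGb : ∀ y, G y ≤ C * Real.exp (-b * (y - x) ^ 2) := by
    intro y
    rw [hC, ← Real.exp_add]
    refine Real.exp_le_exp.mpr ?_
    have e : -b * (y - x) ^ 2 = -((y - x) ^ 2 / (4 * τ)) / (2 * ε) := by
      rw [hb]; field_simp; ring
    rw [e, ← add_div]
    gcongr
    unfold thetaFn
    have h1 := (abs_le.mp (hUb y)).1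
    have h2 : |y| ≤ |x| + |y - x| := by
      have := abs_add_le x (y - x); simpa using this
    have h3 : M * |y| ≤ M * |x| + M * |y - x| := by nlinarith
    have h4 : M * |y - x| ≤ (y - x) ^ 2 / (4 * τ) + M ^ 2 * τ := by
      rw [← sub_nonneg, ← sq_abs (y - x)]
      have : |y - x| ^ 2 / (4 * τ) + M ^ 2 * τ - M * |y - x|
          = (|y - x| - 2 * τ * M) ^ 2 / (4 * τ) := by field_simp; ring
      rw [this]; positivity
    have h5 : (x - y) ^ 2 / (2 * τ) = (y - x) ^ 2 / (4 * τ) + (y - x) ^ 2 / (4 * τ) := by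
      field_simp; ring
    linarith
  have hG0 : ∀ y, 0 ≤ G y := fun y => (Real.exp_pos _).le
  have hGi : Integrable G := by
    refine Integrable.mono' (((integrable_exp_neg_mul_sq hb0).comp_sub_right x).const_mul C)
      hGc.aestronglyMeasurable (Eventually.of_forall fun y => ?_)
    rw [Real.norm_of_nonneg (hG0 y)]
    exact hGb y
  have hyGi : Integrable (fun y => ((y - x) / τ) * G y) := by
    refine Integrable.mono'
      (((integrable_mul_exp_neg_mul_sq hb0).comp_sub_right x).norm.const_mul (C / τ))
      (by fun_prop) (Eventually.of_forall fun y => ?_)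
    simp only [norm_mul, norm_div, Real.norm_of_nonneg (hG0 y), Real.norm_eq_abs, abs_of_pos hτ,
      Real.abs_exp]
    calc |y - x| / τ * G y ≤ |y - x| / τ * (C * Real.exp (-b * (y - x) ^ 2)) := by
          gcongr; exact hGb y
      _ = _ := by ring
  have huGi : Integrable (fun y => u0 y * G y) :=
    hGi.bdd_mul (c := M) hu0m.aestronglyMeasurable
      (Eventually.of_forall fun y => by simpa using hM y)
  have hFi : Integrable (fun y => ((y - x) / τ + u0 y) * G y) := by
    refine (hyGi.add huGi).congr (Eventually.of_forall fun y => ?_)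
    simp only [Pi.add_apply]
    ring
  have hlim : ∀ l : Filter ℝ, Tendsto (fun y : ℝ => (y - x) ^ 2) l atTop →
      Tendsto G l (nhds 0) := by
    intro l hl
    refine squeeze_zero hG0 hGb ?_
    have h1 := Real.tendsto_exp_atBot.comp (hl.const_mul_atTop_of_neg (neg_lt_zero.mpr hb0))
    simpa using h1.const_mul C
  have htop : Tendsto G atTop (nhds 0) := hlim _
    ((tendsto_pow_atTop two_ne_zero).comp (tendsto_atTop_add_const_right _ (-x) tendsto_id))
  have hbot : Tendsto G atBot (nhds 0) := by
    refine hlim _ ?_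
    have : Tendsto (fun y : ℝ => (x + -y) ^ 2) atBot atTop :=
      (tendsto_pow_atTop two_ne_zero).comp
        (tendsto_atTop_add_const_left _ x tendsto_neg_atBot_atTop)
    refine this.congr fun y => by ring
  have hFTC : ∀ n : ℝ, ∫ y in (-n)..n, ((y - x) / τ + u0 y) * G y
      = (-(2 * ε)) * (G n - G (-n)) := by
    intro n
    have hac : AbsolutelyContinuousOnInterval G (-n) n := by
      obtain ⟨K, hK⟩ := LocallyLipschitzOn.exists_lipschitzOnWith_of_compact
        (isCompact_uIcc (a := -n) (b := n)) (hLL.locallyLipschitzOn)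
      exact hK.absolutelyContinuousOnInterval
    rw [← hac.integral_deriv_eq_sub, ← intervalIntegral.integral_const_mul]
    refine intervalIntegral.integral_congr_ae ?_
    filter_upwards [hder] with y hy _
    rw [hy]
    field_simp
  have hmain : (∫ y : ℝ, ((y - x) / τ + u0 y) * G y) = 0 := by
    have h1 := intervalIntegral_tendsto_integral hFi tendsto_neg_atTop_atBot tendsto_id
    refine tendsto_nhds_unique h1 ?_
    simp only [id, hFTC]
    simpa using (htop.sub (hbot.comp tendsto_neg_atTop_atBot)).const_mul (-(2 * ε))
  refine ⟨hmain, ?_⟩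
  simp only [add_mul] at hmain
  rw [integral_add hyGi huGi] at hmain
  have : (∫ y : ℝ, ((x - y) / τ) * G y) = -∫ y : ℝ, ((y - x) / τ) * G y := by
    rw [← integral_neg]
    congr 1
    ext y
    ring
  rw [this]
  linarith
end

section
/- Let k, l : ℝ → ℝ be continuous functions such that: (i) l grows at most linearly, i.e. there is C > 0 with |l(y)| ≤ C(1 + |y|) for all y; (ii) k grows at least quadratically, i.e. there are c > 0 and R > 0 with k(y) ≥ c y² for all |y| ≥ R; and (iii) there is a unique point y0 ∈ ℝ such that k(y0) = inf_{y ∈ ℝ} k(y) (in particular the infimum is attained only at y0). Then lim_{ε → 0⁺} (∫_ℝ l(y) e^{−k(y)/ε} dy) / (∫_ℝ e^{−k(y)/ε} dy) = l(y0). -/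
open Real Filter MeasureTheory

lemma lap_integrable_aux (k l : ℝ → ℝ) (hk : Continuous k) (hl : Continuous l)
    (C c B : ℝ) (hc : 0 < c) (hC : ∀ y, |l y| ≤ C * (1 + |y|))
    (hB : ∀ y, c * y ^ 2 - B ≤ k y) (ε : ℝ) (hε : 0 < ε) :
    Integrable (fun y : ℝ => l y * Real.exp (-(k y) / ε)) := by
  have h1 : Integrable (fun y : ℝ => Real.exp (-(c / ε) * y ^ 2)) :=
    integrable_exp_neg_mul_sq (by positivity)
  have h2 : Integrable (fun y : ℝ => y * Real.exp (-(c / ε) * y ^ 2)) :=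
    integrable_mul_exp_neg_mul_sq (by positivity)
  have h3 := ((h1.add h2.norm).const_mul (C * Real.exp (B / ε)))
  refine h3.mono' (by fun_prop) (Eventually.of_forall fun y => ?_)
  have hE : Real.exp (-(k y) / ε) ≤ Real.exp (B / ε) * Real.exp (-(c / ε) * y ^ 2) := by
    rw [← Real.exp_add]
    apply Real.exp_le_exp.2
    have : B / ε + -(c / ε) * y ^ 2 = (B - c * y ^ 2) / ε := by ring
    rw [this]
    exact div_le_div_of_nonneg_right (by linarith [hB y]) hε.le
  simp only [norm_mul, Real.norm_eq_abs, Real.abs_exp, Pi.add_apply]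
  calc |l y| * Real.exp (-(k y) / ε)
      ≤ (C * (1 + |y|)) * (Real.exp (B / ε) * Real.exp (-(c / ε) * y ^ 2)) :=
        mul_le_mul (hC y) hE (Real.exp_pos _).le ((abs_nonneg _).trans (hC y))
    _ = _ := by ring

/-- **Laplace-type asymptotic lemma.**
If `l` is continuous with at most linear growth, `k` is continuous with at least quadratic
growth, and `k` attains its infimum at a unique point `y0`, then
`(∫ l(y) e^{-k(y)/ε} dy) / (∫ e^{-k(y)/ε} dy) → l(y0)` as `ε → 0⁺`. -/
theorem laplace_asymptotics_unique_minimizer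
    (k l : ℝ → ℝ) (hk : Continuous k) (hl : Continuous l)
    (hlgrowth : ∃ C > 0, ∀ y, |l y| ≤ C * (1 + |y|))
    (hkgrowth : ∃ c > 0, ∃ R > 0, ∀ y : ℝ, R ≤ |y| → c * y ^ 2 ≤ k y)
    (y0 : ℝ) (hmin : ∀ y, k y0 ≤ k y) (huniq : ∀ y, k y = k y0 → y = y0) :
    Tendsto
      (fun ε : ℝ =>
        (∫ y : ℝ, l y * Real.exp (-(k y) / ε)) / (∫ y : ℝ, Real.exp (-(k y) / ε)))
      (nhdsWithin 0 (Set.Ioi 0)) (nhds (l y0)) := by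
  obtain ⟨C, hCpos, hC⟩ := hlgrowth
  obtain ⟨c, hc, R, hR, hkR⟩ := hkgrowth
  obtain ⟨B, hB⟩ : ∃ B, ∀ y, c * y ^ 2 - B ≤ k y := by
    refine ⟨c * R ^ 2 + |k y0|, fun y => ?_⟩
    rcases le_total R |y| with h | h
    · have := hkR y h
      have : 0 ≤ c * R ^ 2 := by positivity
      linarith [abs_nonneg (k y0)]
    · have h1 : y ^ 2 ≤ R ^ 2 := by
        rw [← sq_abs y]; gcongr
      have := mul_le_mul_of_nonneg_left h1 hc.le
      linarith [hmin y, neg_abs_le (k y0)]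
  have hint : ∀ ε : ℝ, 0 < ε → Integrable (fun y : ℝ => Real.exp (-(k y) / ε)) := by
    intro ε hε
    have := lap_integrable_aux k (fun _ => 1) hk continuous_const 1 c B hc
      (fun y => by simp) hB ε hε
    simpa using this
  have hintl := lap_integrable_aux k l hk hl C c B hc hC hB
  have hcoer : Tendsto k (cocompact ℝ) atTop := by
    have h1 : Tendsto (fun y : ℝ => c * ‖y‖ ^ 2 + (-B)) (cocompact ℝ) atTop :=
      tendsto_atTop_add_const_right _ _
        (((tendsto_pow_atTop two_ne_zero).comp (tendsto_norm_cocompact_atTop)).const_mul_atTop hc)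
    refine tendsto_atTop_mono (fun y => ?_) h1
    have := hB y
    simp only [Real.norm_eq_abs, sq_abs]
    linarith
  rw [Metric.tendsto_nhds]
  intro η hη
  obtain ⟨δ, hδ, hlδ⟩ := Metric.continuousAt_iff.1 (hl.continuousAt (x := y0)) (η / 2) (by positivity)
  obtain ⟨a, ha, hka⟩ : ∃ a > 0, ∀ y, δ ≤ dist y y0 → k y0 + a ≤ k y := by
    have hcl : IsClosed {y : ℝ | δ ≤ dist y y0} :=
      isClosed_le continuous_const (by fun_prop)
    have hmem : y0 + δ ∈ {y : ℝ | δ ≤ dist y y0} := by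
      simp [Real.dist_eq, abs_of_pos hδ]
    obtain ⟨z, hz, hzmin⟩ := hk.continuousOn.exists_isMinOn' hcl hmem
      ((hcoer.eventually (eventually_ge_atTop _)).filter_mono inf_le_left)
    refine ⟨k z - k y0, ?_, fun y hy => ?_⟩
    · have h1 : k z ≠ k y0 := by
        intro h
        have := huniq z h
        subst this
        simp at hz
        linarith
      exact sub_pos.2 (lt_of_le_of_ne (hmin z) (Ne.symm h1))
    · have : k z ≤ k y := hzmin hy
      linarith
  obtain ⟨r, hr, hkr⟩ := Metric.continuousAt_iff.1 (hk.continuousAt (x := y0)) (a / 2) (by positivity)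
  set A : ℝ := ∫ y, |l y - l y0| * Real.exp (-(k y) / 1) with hA
  have hintd : ∀ ε : ℝ, 0 < ε →
      Integrable (fun y : ℝ => (l y - l y0) * Real.exp (-(k y) / ε)) := by
    intro ε hε
    have := (hintl ε hε).sub ((hint ε hε).const_mul (l y0))
    refine this.congr (Eventually.of_forall fun y => ?_)
    simp only [Pi.sub_apply]
    ring
  have hintabs : ∀ ε : ℝ, 0 < ε →
      Integrable (fun y : ℝ => |l y - l y0| * Real.exp (-(k y) / ε)) := by
    intro ε hε
    refine (hintd ε hε).norm.congr (Eventually.of_forall fun y => ?_)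
    simp
  have hAnn : 0 ≤ A := integral_nonneg fun y => by positivity
  have hlower : ∀ ε : ℝ, 0 < ε →
      2 * r * Real.exp (-(k y0 + a / 2) / ε) ≤ ∫ y : ℝ, Real.exp (-(k y) / ε) := by
    intro ε hε
    calc 2 * r * Real.exp (-(k y0 + a / 2) / ε)
        = ∫ y in Metric.ball y0 r, Real.exp (-(k y0 + a / 2) / ε) := by
          simp [Measure.real, Real.volume_ball, hr.le]
      _ ≤ ∫ y in Metric.ball y0 r, Real.exp (-(k y) / ε) := by
          refine setIntegral_mono_on ?_ (hint ε hε).integrableOn measurableSet_ball ?_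
          · exact integrableOn_const measure_ball_lt_top.ne
          · intro y hy
            have h1 := hkr (Metric.mem_ball.1 hy)
            rw [Real.dist_eq] at h1
            have h2 := (abs_lt.1 h1).2
            apply Real.exp_le_exp.2
            exact div_le_div_of_nonneg_right (by linarith) hε.le
      _ ≤ _ := setIntegral_le_integral (hint ε hε)
          (Eventually.of_forall fun y => (Real.exp_pos _).le)
  have hlim : Tendsto (fun ε : ℝ => A * Real.exp (k y0 + a) / (2 * r) * Real.exp (-(a / 2 * ε⁻¹)))
      (nhdsWithin 0 (Set.Ioi 0)) (nhds 0) := by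
    have h1 : Tendsto (fun ε : ℝ => a / 2 * ε⁻¹) (nhdsWithin 0 (Set.Ioi 0)) atTop :=
      tendsto_inv_nhdsGT_zero.const_mul_atTop (by positivity)
    simpa using (Real.tendsto_exp_neg_atTop_nhds_zero.comp h1).const_mul
      (A * Real.exp (k y0 + a) / (2 * r))
  filter_upwards [hlim.eventually (gt_mem_nhds (half_pos hη)), Ioo_mem_nhdsGT (zero_lt_one' ℝ)]
    with ε hε1 hε2
  obtain ⟨hε, hεlt⟩ := hε2
  set D : ℝ := ∫ y : ℝ, Real.exp (-(k y) / ε) with hD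
  have hlow := hlower ε hε
  have hDpos : 0 < D := lt_of_lt_of_le (by positivity) hlow
  have hinv : 0 ≤ ε⁻¹ - 1 := by
    have := (one_le_inv₀ hε).2 hεlt.le
    linarith
  have hnum : (∫ y : ℝ, l y * Real.exp (-(k y) / ε)) - l y0 * D
      = ∫ y : ℝ, (l y - l y0) * Real.exp (-(k y) / ε) := by
    rw [hD, ← integral_const_mul, ← integral_sub (hintl ε hε) ((hint ε hε).const_mul _)]
    congr 1
    ext y
    ring
  set K : ℝ := Real.exp (-(k y0 + a) * (ε⁻¹ - 1)) with hK
  have hbound : |∫ y : ℝ, (l y - l y0) * Real.exp (-(k y) / ε)| ≤ η / 2 * D + K * A := by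
    rw [← Real.norm_eq_abs]
    refine (norm_integral_le_integral_norm _).trans ?_
    rw [hD, hA, ← integral_const_mul, ← integral_const_mul, ← integral_add
      ((hint ε hε).const_mul _) ((hintabs 1 one_pos).const_mul _)]
    refine integral_mono (hintd ε hε).norm
      (((hint ε hε).const_mul _).add ((hintabs 1 one_pos).const_mul _)) fun y => ?_
    simp only [norm_mul, Real.norm_eq_abs, Real.abs_exp]
    rcases lt_or_ge (dist y y0) δ with h | h
    · have h1 := (hlδ h).le
      rw [Real.dist_eq] at h1
      have h2 := mul_le_mul_of_nonneg_right h1 (Real.exp_pos (-(k y) / ε)).le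
      have h3 : 0 ≤ K * (|l y - l y0| * Real.exp (-(k y) / 1)) := by positivity
      linarith
    · have h1 : Real.exp (-(k y) / ε) ≤ K * Real.exp (-(k y) / 1) := by
        rw [hK, ← Real.exp_add]
        apply Real.exp_le_exp.2
        have := mul_le_mul_of_nonneg_right (hka y h) hinv
        rw [div_eq_mul_inv]
        linarith
      have h2 := mul_le_mul_of_nonneg_left h1 (abs_nonneg (l y - l y0))
      have h3 : 0 ≤ η / 2 * Real.exp (-(k y) / ε) := by positivity
      linarith
  have hKA : K * A < η / 2 * D := by
    have h1 : K * A = (A * Real.exp (k y0 + a) / (2 * r) * Real.exp (-(a / 2 * ε⁻¹))) *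
        (2 * r * Real.exp (-(k y0 + a / 2) / ε)) := by
      have : K = Real.exp (k y0 + a) * Real.exp (-(a / 2 * ε⁻¹)) *
          Real.exp (-(k y0 + a / 2) / ε) := by
        rw [hK, ← Real.exp_add, ← Real.exp_add]
        congr 1
        ring
      rw [this]
      field_simp
    rw [h1]
    calc _ < η / 2 * (2 * r * Real.exp (-(k y0 + a / 2) / ε)) :=
          mul_lt_mul_of_pos_right hε1 (by positivity)
      _ ≤ _ := by gcongr
  have heq : (∫ y : ℝ, l y * Real.exp (-(k y) / ε)) / D - l y0
      = (∫ y : ℝ, (l y - l y0) * Real.exp (-(k y) / ε)) / D := by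
    rw [← hnum]
    field_simp
  rw [Real.dist_eq, heq, abs_div, abs_of_pos hDpos, div_lt_iff₀ hDpos]
  linarith
end

section
/- Let u0 ∈ L^∞(ℝ) be measurable and fix τ > 0. Then the set of points x ∈ ℝ for which the function y ↦ θ(x, y, τ) has more than one global minimizer is at most countable. -/
open Real Filter MeasureTheory

/-- Minimizers are monotone in `x`. -/
theorem thetaFn_minimizer_mono (u0 : ℝ → ℝ) (τ : ℝ) (hτ : 0 < τ) {x x' y y' : ℝ} (hx : x < x')
    (h : ∀ z : ℝ, thetaFn u0 x y τ ≤ thetaFn u0 x z τ)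
    (h' : ∀ z : ℝ, thetaFn u0 x' y' τ ≤ thetaFn u0 x' z τ) : y ≤ y' := by
  have h1 := h y'
  have h2 := h' y
  unfold thetaFn at h1 h2
  have h3 : (x - y) ^ 2 / (2 * τ) + (x' - y') ^ 2 / (2 * τ)
      ≤ (x - y') ^ 2 / (2 * τ) + (x' - y) ^ 2 / (2 * τ) := by linarith
  rw [← add_div, ← add_div, div_le_div_iff_of_pos_right (by positivity)] at h3
  by_contra hc
  push Not at hc
  nlinarith [mul_pos (sub_pos.2 hx) (sub_pos.2 hc)]

/-- **Hopf.** For bounded measurable `u0` and fixed `τ > 0`, the set of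
`x ∈ ℝ` at which `y ↦ θ(x, y, τ)` has more than one global minimizer is at most countable. -/
theorem theta_nonunique_minimizer_countable
    (u0 : ℝ → ℝ) (hu0m : Measurable u0) (hu0b : ∃ M, ∀ y, |u0 y| ≤ M)
    (τ : ℝ) (hτ : 0 < τ) :
    Set.Countable {x : ℝ | ∃ y₁ y₂ : ℝ, y₁ ≠ y₂ ∧
      (∀ y : ℝ, thetaFn u0 x y₁ τ ≤ thetaFn u0 x y τ) ∧
      (∀ y : ℝ, thetaFn u0 x y₂ τ ≤ thetaFn u0 x y τ)} := by
  have key : ∀ x ∈ {x : ℝ | ∃ y₁ y₂ : ℝ, y₁ ≠ y₂ ∧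
      (∀ y : ℝ, thetaFn u0 x y₁ τ ≤ thetaFn u0 x y τ) ∧
      (∀ y : ℝ, thetaFn u0 x y₂ τ ≤ thetaFn u0 x y τ)},
      ∃ q : ℚ, ∃ a b : ℝ, a < q ∧ (q : ℝ) < b ∧
      (∀ y : ℝ, thetaFn u0 x a τ ≤ thetaFn u0 x y τ) ∧
      (∀ y : ℝ, thetaFn u0 x b τ ≤ thetaFn u0 x y τ) := by
    rintro x ⟨a, b, hab, ha, hb⟩
    rcases lt_or_gt_of_ne hab with h | h
    · obtain ⟨q, h1, h2⟩ := exists_rat_btwn h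
      exact ⟨q, a, b, h1, h2, ha, hb⟩
    · obtain ⟨q, h1, h2⟩ := exists_rat_btwn h
      exact ⟨q, b, a, h1, h2, hb, ha⟩
  choose! q a b haq hqb ha hb using key
  refine Set.MapsTo.countable_of_injOn (f := q) (t := Set.univ) (fun _ _ => Set.mem_univ _) ?_
    Set.countable_univ
  have lt : ∀ x x', x < x' → x ∈ _ → x' ∈ _ → (q x : ℝ) < q x' := fun x x' hlt hx hx' =>
    (hqb x hx).trans_le ((thetaFn_minimizer_mono u0 τ hτ hlt (hb x hx) (ha x' hx')).trans
      (haq x' hx').le)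
  intro x hx x' hx' heq
  rcases lt_trichotomy x x' with h | h | h
  · exact absurd (congrArg (Rat.cast : ℚ → ℝ) heq) (lt x x' h hx hx').ne
  · exact h
  · exact absurd (congrArg (Rat.cast : ℚ → ℝ) heq) (lt x' x h hx' hx).ne'
end

section
/- Let α ≠ 0 be a real constant and u0 ∈ L^∞(ℝ) measurable. Fix x ∈ ℝ and t > 0 and suppose the function y ↦ θ(x, y, τ(t)) has a unique global minimizer y0 ∈ ℝ. Then lim_{ε → 0⁺} u^ε(x, t) = e^{−αt} (x − y0)/τ(t). -/
open Real Filter MeasureTheory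

/-- The time change `τ(t) = (1 - e^{-αt})/α`. -/
noncomputable def tauChange (α t : ℝ) : ℝ := (1 - Real.exp (-α * t)) / α

/-- The viscous approximation
`u^ε(x,t) = e^{-αt} (∫ ((x-y)/τ(t)) e^{-θ/(2ε)} dy) / (∫ e^{-θ/(2ε)} dy)`. -/
noncomputable def uVisc (α : ℝ) (u0 : ℝ → ℝ) (ε x t : ℝ) : ℝ :=
  Real.exp (-α * t) *
    (∫ y : ℝ, ((x - y) / tauChange α t) *
      Real.exp (-(thetaFn u0 x y (tauChange α t)) / (2 * ε))) /
    (∫ y : ℝ, Real.exp (-(thetaFn u0 x y (tauChange α t)) / (2 * ε)))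

theorem laplace_aux (φ : ℝ → ℝ) (hc : Continuous φ) (y0 : ℝ) (h0 : φ y0 = 0)
    (hnn : ∀ y, 0 ≤ φ y)
    (hm : ∀ δ > 0, ∃ m > 0, ∀ y, δ ≤ |y - y0| → m ≤ φ y)
    (hi0 : ∀ k : ℝ, 1 ≤ k → Integrable (fun y => Real.exp (-(k * φ y))))
    (hi1 : ∀ k : ℝ, 1 ≤ k → Integrable (fun y => (y - y0) * Real.exp (-(k * φ y)))) :
    Tendsto (fun k : ℝ => (∫ y, (y - y0) * Real.exp (-(k * φ y))) /
      (∫ y, Real.exp (-(k * φ y)))) atTop (nhds 0) := by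
  rw [Metric.tendsto_nhds]
  intro e he
  obtain ⟨m, hm0, hmm⟩ := hm (e / 2) (by positivity)
  have hev : ∀ᶠ y in nhds y0, φ y < m / 2 :=
    hc.continuousAt.eventually_lt continuousAt_const (by rw [h0]; positivity)
  obtain ⟨η, hη, hball⟩ := Metric.eventually_nhds_iff.1 hev
  set C := ∫ y, |y - y0| * Real.exp (-(1 * φ y)) with hC
  have hC0 : 0 ≤ C := integral_nonneg (fun y => by positivity)
  have hlim : Tendsto (fun k : ℝ => Real.exp m * C / η * Real.exp (-(k * (m / 2)))) atTop
      (nhds (Real.exp m * C / η * 0)) := by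
    apply Tendsto.const_mul
    apply Real.tendsto_exp_neg_atTop_nhds_zero.comp
    exact tendsto_id.atTop_mul_const (by positivity)
  rw [mul_zero] at hlim
  filter_upwards [eventually_ge_atTop 1, hlim.eventually_lt_const (half_pos he)] with k hk hsmall
  rw [Real.dist_eq, sub_zero]
  have hiabs : ∀ k : ℝ, 1 ≤ k → Integrable (fun y => |y - y0| * Real.exp (-(k * φ y))) := by
    intro k hk
    refine (hi1 k hk).abs.congr (Eventually.of_forall fun y => ?_)
    simp [abs_mul]
  have hD : η * Real.exp (-(k * (m / 2))) ≤ ∫ y, Real.exp (-(k * φ y)) := by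
    have h1 : ∫ y in Set.Ioo y0 (y0 + η), Real.exp (-(k * (m / 2)))
        ≤ ∫ y in Set.Ioo y0 (y0 + η), Real.exp (-(k * φ y)) := by
      apply setIntegral_mono_on
      · simp
      · exact (hi0 k hk).integrableOn
      · exact measurableSet_Ioo
      · intro y hy
        have := hball (y := y) (by
          rw [Real.dist_eq, abs_lt]; constructor <;> linarith [hy.1, hy.2])
        apply Real.exp_le_exp.2
        have : k * φ y ≤ k * (m / 2) := by gcongr
        linarith
    have h2 : ∫ y in Set.Ioo y0 (y0 + η), Real.exp (-(k * φ y)) ≤ ∫ y, Real.exp (-(k * φ y)) :=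
      setIntegral_le_integral (hi0 k hk) (Eventually.of_forall fun y => by positivity)
    have h3 : ∫ y in Set.Ioo y0 (y0 + η), Real.exp (-(k * (m / 2)))
        = η * Real.exp (-(k * (m / 2))) := by
      simp [hη.le]
    linarith
  have hN : |∫ y, (y - y0) * Real.exp (-(k * φ y))| ≤
      e / 2 * (∫ y, Real.exp (-(k * φ y))) + Real.exp (-((k - 1) * m)) * C := by
    calc |∫ y, (y - y0) * Real.exp (-(k * φ y))|
        ≤ ∫ y, |(y - y0) * Real.exp (-(k * φ y))| := abs_integral_le_integral_abs
      _ ≤ ∫ y, (e / 2 * Real.exp (-(k * φ y)) +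
            Real.exp (-((k - 1) * m)) * (|y - y0| * Real.exp (-(1 * φ y)))) := by
          apply integral_mono (hi1 k hk).abs
          · exact ((hi0 k hk).const_mul _).add ((hiabs 1 le_rfl).const_mul _)
          · intro y
            simp only [abs_mul, Real.abs_exp]
            rcases le_total (|y - y0|) (e / 2) with h | h
            · have : 0 ≤ Real.exp (-((k - 1) * m)) * (|y - y0| * Real.exp (-(1 * φ y))) := by
                positivity
              have : |y - y0| * Real.exp (-(k * φ y)) ≤ e / 2 * Real.exp (-(k * φ y)) := by
                gcongr
              linarith
            · have h1 : Real.exp (-(k * φ y)) ≤ Real.exp (-((k - 1) * m)) * Real.exp (-(1 * φ y)) := by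
                rw [← Real.exp_add]
                apply Real.exp_le_exp.2
                have : (k - 1) * m ≤ (k - 1) * φ y :=
                  mul_le_mul_of_nonneg_left (hmm y h) (by linarith)
                linarith
              have h2 : 0 ≤ e / 2 * Real.exp (-(k * φ y)) := by positivity
              have h3 := mul_le_mul_of_nonneg_left h1 (abs_nonneg (y - y0))
              linarith
      _ = _ := by
          rw [integral_add ((hi0 k hk).const_mul _) ((hiabs 1 le_rfl).const_mul _),
            integral_const_mul, integral_const_mul]
  set D := ∫ y, Real.exp (-(k * φ y)) with hDdef
  have hDpos : 0 < D := lt_of_lt_of_le (by positivity) hD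
  rw [abs_div, abs_of_pos hDpos, div_lt_iff₀ hDpos]
  have hkey : Real.exp (-((k - 1) * m)) * C =
      (Real.exp m * C / η * Real.exp (-(k * (m / 2)))) * (η * Real.exp (-(k * (m / 2)))) := by
    have : Real.exp (-((k - 1) * m)) =
        Real.exp m * Real.exp (-(k * (m / 2))) * Real.exp (-(k * (m / 2))) := by
      rw [← Real.exp_add, ← Real.exp_add]; congr 1; ring
    rw [this]; field_simp
  have h4 : Real.exp (-((k - 1) * m)) * C ≤
      (Real.exp m * C / η * Real.exp (-(k * (m / 2)))) * D := by
    rw [hkey]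
    exact mul_le_mul_of_nonneg_left hD (by positivity)
  have h5 := mul_lt_mul_of_pos_right hsmall hDpos
  linarith

theorem laplace_quad (φ : ℝ → ℝ) (hc : Continuous φ) (y0 : ℝ) (h0 : φ y0 = 0)
    (hpos : ∀ y, y ≠ y0 → 0 < φ y) (a b : ℝ) (ha : 0 < a)
    (hq : ∀ y, a * (y - y0) ^ 2 - b ≤ φ y) :
    (∀ k : ℝ, 1 ≤ k → Integrable (fun y => Real.exp (-(k * φ y)))) ∧
    (∀ k : ℝ, 1 ≤ k → Integrable (fun y => (y - y0) * Real.exp (-(k * φ y)))) ∧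
    (∀ y, 0 ≤ φ y) ∧
    (∀ δ > 0, ∃ m > 0, ∀ y, δ ≤ |y - y0| → m ≤ φ y) := by
  have hnn : ∀ y, 0 ≤ φ y := by
    intro y
    by_cases h : y = y0
    · rw [h, h0]
    · exact (hpos y h).le
  have hle : ∀ k : ℝ, 1 ≤ k → ∀ y,
      Real.exp (-(k * φ y)) ≤ Real.exp b * Real.exp (-a * (y - y0) ^ 2) := by
    intro k hk y
    rw [← Real.exp_add]
    apply Real.exp_le_exp.2
    have := mul_le_mul_of_nonneg_right hk (hnn y)
    have := hq y
    linarith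
  refine ⟨fun k hk => ?_, fun k hk => ?_, hnn, fun δ hδ => ?_⟩
  · refine Integrable.mono' (((integrable_exp_neg_mul_sq ha).comp_sub_right y0).const_mul
      (Real.exp b)) (by fun_prop) (Eventually.of_forall fun y => ?_)
    rw [Real.norm_eq_abs, Real.abs_exp]
    exact hle k hk y
  · refine Integrable.mono' (((integrable_mul_exp_neg_mul_sq ha).comp_sub_right y0).abs.const_mul
      (Real.exp b)) (by fun_prop) (Eventually.of_forall fun y => ?_)
    rw [Real.norm_eq_abs, abs_mul, Real.abs_exp, abs_mul, Real.abs_exp]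
    have := mul_le_mul_of_nonneg_left (hle k hk y) (abs_nonneg (y - y0))
    linarith
  · set R := (|b| + 1) / a + 1 with hR
    have hR1 : 1 ≤ R := by rw [hR]; linarith [show 0 ≤ (|b| + 1) / a by positivity]
    have haR : |b| + 1 ≤ a * R := by
      rw [hR, mul_add, mul_div_cancel₀ _ ha.ne']; linarith
    have hbig : ∀ y, R ≤ |y - y0| → 1 ≤ φ y := by
      intro y hy
      have h1 : R ≤ (y - y0) ^ 2 := by rw [← sq_abs]; nlinarith
      have h2 := mul_le_mul_of_nonneg_left h1 ha.le
      have := hq y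
      have := le_abs_self b
      linarith
    have hK : IsCompact (Metric.closedBall y0 R ∩ {y | δ ≤ |y - y0|}) :=
      (isCompact_closedBall y0 R).inter_right (isClosed_le continuous_const (by fun_prop))
    rcases (Metric.closedBall y0 R ∩ {y | δ ≤ |y - y0|}).eq_empty_or_nonempty with he | hne
    · refine ⟨1, one_pos, fun y hy => hbig y ?_⟩
      by_contra! h
      have : y ∈ Metric.closedBall y0 R ∩ {y | δ ≤ |y - y0|} :=
        ⟨by rw [Metric.mem_closedBall, Real.dist_eq]; exact h.le, hy⟩
      rw [he] at this
      exact this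
    · obtain ⟨z, hz, hzm⟩ := hK.exists_isMinOn hne hc.continuousOn
      have hzne : z ≠ y0 := by
        rintro rfl
        have := hz.2
        simp at this
        linarith
      refine ⟨min 1 (φ z), lt_min one_pos (hpos z hzne), fun y hy => ?_⟩
      rcases le_total R (|y - y0|) with h | h
      · exact (min_le_left _ _).trans (hbig y h)
      · exact (min_le_right _ _).trans (hzm
          ⟨by rw [Metric.mem_closedBall, Real.dist_eq]; exact h, hy⟩)

/-- **vanishing viscosity limit of `u^ε`.**
If `y ↦ θ(x, y, τ(t))` has a unique global minimizer `y0`, then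
`u^ε(x, t) → e^{-αt}(x - y0)/τ(t)` as `ε → 0⁺`. -/
theorem uVisc_vanishing_viscosity_limit
    (α : ℝ) (hα : α ≠ 0) (u0 : ℝ → ℝ) (hu0m : Measurable u0)
    (hu0b : ∃ M, ∀ y, |u0 y| ≤ M)
    (x t : ℝ) (ht : 0 < t) (y0 : ℝ)
    (hmin : ∀ y : ℝ, thetaFn u0 x y0 (tauChange α t) ≤ thetaFn u0 x y (tauChange α t))
    (huniq : ∀ y : ℝ, (∀ z : ℝ, thetaFn u0 x y (tauChange α t) ≤ thetaFn u0 x z (tauChange α t))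
      → y = y0) :
    Tendsto (fun ε : ℝ => uVisc α u0 ε x t)
      (nhdsWithin 0 (Set.Ioi 0))
      (nhds (Real.exp (-α * t) * (x - y0) / tauChange α t)) := by
  obtain ⟨M, hM⟩ := hu0b
  have hτ : 0 < tauChange α t := by
    unfold tauChange
    rcases lt_or_gt_of_ne hα with h | h
    · apply div_pos_of_neg_of_neg _ h
      have : 1 < Real.exp (-α * t) := Real.one_lt_exp_iff.2 (by nlinarith)
      linarith
    · apply div_pos _ h
      have : Real.exp (-α * t) < 1 := Real.exp_lt_one_iff.2 (by nlinarith)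
      linarith
  unfold uVisc
  generalize tauChange α t = τ at *
  have hM0 : 0 ≤ M := (abs_nonneg _).trans (hM 0)
  have hint : ∀ a b : ℝ, IntervalIntegrable u0 volume a b := by
    intro a b
    refine (intervalIntegrable_const (c := M)).mono_fun' hu0m.aestronglyMeasurable ?_
    exact Eventually.of_forall fun y => hM y
  have hcont : Continuous (fun y => thetaFn u0 x y τ) := by
    unfold thetaFn
    exact (by fun_prop : Continuous fun y => (x - y) ^ 2 / (2 * τ)).add
      (intervalIntegral.continuous_primitive hint 0)
  set c := thetaFn u0 x y0 τ with hcdef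
  set φ : ℝ → ℝ := fun y => thetaFn u0 x y τ - c with hφ
  have hpos : ∀ y, y ≠ y0 → 0 < φ y := by
    intro y hy
    by_contra! h
    apply hy
    apply huniq
    intro z
    have := hmin z
    simp only [hφ] at h
    linarith
  have hq : ∀ y, 1 / (8 * τ) * (y - y0) ^ 2 -
      ((x - y0) ^ 2 / (2 * τ) + 2 * τ * M ^ 2 + M * |y0| + c) ≤ φ y := by
    intro y
    have hI : |∫ s in (0:ℝ)..y, u0 s| ≤ M * |y| := by
      have := intervalIntegral.norm_integral_le_of_norm_le_const (a := 0) (b := y) (f := u0)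
        (C := M) (fun s _ => hM s)
      simpa using this
    have h1 := (abs_le.1 hI).1
    have h2 : |y| ≤ |y - y0| + |y0| := by
      have := abs_add_le (y - y0) y0
      simpa using this
    have h3 : M * |y| ≤ M * |y - y0| + M * |y0| := by
      rw [← mul_add]; exact mul_le_mul_of_nonneg_left h2 hM0
    have h4 : M * |y - y0| ≤ 1 / (8 * τ) * (y - y0) ^ 2 + 2 * τ * M ^ 2 := by
      have : 1 / (8 * τ) * (y - y0) ^ 2 + 2 * τ * M ^ 2 - M * |y - y0|
          = (|y - y0| - 4 * τ * M) ^ 2 / (8 * τ) := by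
        rw [← sq_abs (y - y0)]; field_simp; ring
      have h : 0 ≤ (|y - y0| - 4 * τ * M) ^ 2 / (8 * τ) := by positivity
      linarith
    have h5 : 2 * (1 / (8 * τ) * (y - y0) ^ 2) - (x - y0) ^ 2 / (2 * τ)
        ≤ (x - y) ^ 2 / (2 * τ) := by
      have : (x - y) ^ 2 / (2 * τ) - (2 * (1 / (8 * τ) * (y - y0) ^ 2) - (x - y0) ^ 2 / (2 * τ))
          = ((y - y0) - 2 * (x - y0)) ^ 2 / (4 * τ) := by
        field_simp; ring
      have h : 0 ≤ ((y - y0) - 2 * (x - y0)) ^ 2 / (4 * τ) := by positivity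
      linarith
    simp only [hφ]
    rw [thetaFn]
    linarith
  have hφc : Continuous φ := hcont.sub continuous_const
  have hφ0 : φ y0 = 0 := by simp [hφ, hcdef]
  obtain ⟨hi0, hi1, hnn, hm⟩ := laplace_quad φ hφc y0 hφ0 hpos _ _ (by positivity) hq
  have hL := laplace_aux φ hφc y0 hφ0 hnn hm hi0 hi1
  have hk : Tendsto (fun ε : ℝ => (2 * ε)⁻¹) (nhdsWithin 0 (Set.Ioi 0)) atTop := by
    have : Tendsto (fun ε : ℝ => 2⁻¹ * ε⁻¹) (nhdsWithin 0 (Set.Ioi 0)) atTop :=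
      tendsto_inv_nhdsGT_zero.const_mul_atTop (by norm_num)
    refine this.congr fun ε => ?_
    rw [mul_inv]
  have hfin := ((hL.comp hk).const_sub (x - y0)).const_mul (Real.exp (-α * t) / τ)
  rw [sub_zero] at hfin
  have e1 : Real.exp (-α * t) * (x - y0) / τ = Real.exp (-α * t) / τ * (x - y0) := by ring
  rw [e1]
  refine hfin.congr' ?_
  filter_upwards [hk.eventually_ge_atTop 1] with ε hε
  simp only [Function.comp]
  set k := (2 * ε)⁻¹ with hkd
  have hexp : ∀ y, Real.exp (-(thetaFn u0 x y τ) / (2 * ε)) =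
      Real.exp (-(k * c)) * Real.exp (-(k * φ y)) := by
    intro y
    rw [← Real.exp_add, div_eq_mul_inv, ← hkd]
    congr 1
    simp only [hφ]
    ring
  have hDen : ∫ y, Real.exp (-(thetaFn u0 x y τ) / (2 * ε)) =
      Real.exp (-(k * c)) * ∫ y, Real.exp (-(k * φ y)) := by
    simp_rw [hexp]
    rw [integral_const_mul]
  have hNum : ∫ y, ((x - y) / τ) * Real.exp (-(thetaFn u0 x y τ) / (2 * ε)) =
      Real.exp (-(k * c)) / τ * ((x - y0) * (∫ y, Real.exp (-(k * φ y))) -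
        ∫ y, (y - y0) * Real.exp (-(k * φ y))) := by
    rw [← integral_const_mul, ← integral_sub ((hi0 k hε).const_mul _) (hi1 k hε),
      ← integral_const_mul]
    congr 1
    ext y
    rw [hexp]
    ring
  rw [hDen, hNum]
  have hDpos : 0 < ∫ y, Real.exp (-(k * φ y)) := integral_exp_pos (hi0 k hε)
  have hE := Real.exp_pos (-(k * c))
  generalize (∫ y, Real.exp (-(k * φ y))) = D at *
  generalize (∫ y, (y - y0) * Real.exp (-(k * φ y))) = N at *
  field_simp
end

section
/- Let α ≠ 0 be a real constant, u0 ∈ L^∞(ℝ) measurable and v0 ∈ L¹(ℝ). Fix x ∈ ℝ and t > 0 and suppose the function y ↦ θ(x, y, τ(t)) has a unique global minimizer y0 ∈ ℝ. Then lim_{ε → 0⁺} V^ε(x, t) = ∫_0^{y0} v0(s) ds. -/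
open Real Filter MeasureTheory

/-- The viscous approximation
`V^ε(x,t) = (∫ V0(y) e^{-θ/(2ε)} dy) / (∫ e^{-θ/(2ε)} dy)` with `V0(y) = ∫_0^y v0`. -/
noncomputable def VVisc (α : ℝ) (u0 v0 : ℝ → ℝ) (ε x t : ℝ) : ℝ :=
  (∫ y : ℝ, (∫ s in (0:ℝ)..y, v0 s) *
      Real.exp (-(thetaFn u0 x y (tauChange α t)) / (2 * ε))) /
  (∫ y : ℝ, Real.exp (-(thetaFn u0 x y (tauChange α t)) / (2 * ε)))

lemma aux_sep (f : ℝ → ℝ) (hf : Continuous f) (y0 b B : ℝ) (hb : 0 < b)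
    (hcoer : ∀ y, b * y ^ 2 - B ≤ f y) (hpos : ∀ y, y ≠ y0 → 0 < f y)
    (δ : ℝ) (hδ : 0 < δ) : ∃ m > 0, ∀ y, δ ≤ |y - y0| → m ≤ f y := by
  have hcl : IsClosed {y : ℝ | δ ≤ |y - y0|} := isClosed_le (by fun_prop) (by fun_prop)
  have ht : Tendsto f (cocompact ℝ) atTop := by
    refine tendsto_atTop_mono hcoer ?_
    have h1 : Tendsto (fun y : ℝ => ‖y‖ ^ 2) (cocompact ℝ) atTop :=
      (tendsto_pow_atTop two_ne_zero).comp tendsto_norm_cocompact_atTop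
    have h2 := tendsto_atTop_add_const_right _ (-B) (h1.const_mul_atTop hb)
    simpa [sub_eq_add_neg] using h2
  have hmem : y0 + δ ∈ {y : ℝ | δ ≤ |y - y0|} := by
    simp [abs_of_pos hδ]
  obtain ⟨z, hz, hzmin⟩ := hf.continuousOn.exists_isMinOn' hcl hmem
    (((ht.eventually_ge_atTop (f (y0 + δ)))).filter_mono inf_le_left)
  refine ⟨f z, hpos z ?_, fun y hy => hzmin hy⟩
  rintro rfl
  simp at hz
  linarith

lemma aux_laplace (f V : ℝ → ℝ) (hf : Continuous f) (hV : Continuous V) (K : ℝ)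
    (hK : ∀ y, |V y| ≤ K) (y0 b B : ℝ) (hb : 0 < b)
    (hcoer : ∀ y, b * y ^ 2 - B ≤ f y) (h0 : f y0 = 0) (hpos : ∀ y, y ≠ y0 → 0 < f y) :
    Tendsto (fun k : ℝ => (∫ y, V y * Real.exp (-(k * f y))) / (∫ y, Real.exp (-(k * f y))))
      atTop (nhds (V y0)) := by
  have hf0 : ∀ y, 0 ≤ f y := fun y => by
    rcases eq_or_ne y y0 with h | h
    · rw [h, h0]
    · exact (hpos y h).le
  have hint1 : Integrable (fun y => Real.exp (-(f y))) := by
    refine ((integrable_exp_neg_mul_sq hb).const_mul (Real.exp B)).mono'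
      (by fun_prop) (Eventually.of_forall fun y => ?_)
    rw [Real.norm_eq_abs, abs_of_pos (Real.exp_pos _), ← Real.exp_add, Real.exp_le_exp]
    have := hcoer y
    linarith
  have hint : ∀ k : ℝ, 1 ≤ k → Integrable (fun y => Real.exp (-(k * f y))) := by
    intro k hk
    refine hint1.mono' (by fun_prop) (Eventually.of_forall fun y => ?_)
    rw [Real.norm_eq_abs, abs_of_pos (Real.exp_pos _), Real.exp_le_exp]
    nlinarith [hf0 y]
  set I := ∫ y, Real.exp (-(f y)) with hI
  have hI0 : 0 ≤ I := integral_nonneg fun y => (Real.exp_pos _).le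
  have hK0 : 0 ≤ K := (abs_nonneg _).trans (hK 0)
  rw [Metric.tendsto_nhds]
  intro η hη
  obtain ⟨δ, hδ, hVδ⟩ := Metric.continuous_iff.1 hV y0 (η / 2) (by positivity)
  obtain ⟨m, hm, hmf⟩ := aux_sep f hf y0 b B hb hcoer hpos δ hδ
  obtain ⟨r, hr, hfr⟩ := Metric.continuous_iff.1 hf y0 (m / 2) (by positivity)
  have hlim : Tendsto (fun k : ℝ => (2 * K * Real.exp m * I / (2 * r)) * Real.exp (-(k * (m / 2))))
      atTop (nhds 0) := by
    have h1 : Tendsto (fun k : ℝ => k * (m / 2)) atTop atTop :=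
      tendsto_id.atTop_mul_const (by positivity)
    have := (Real.tendsto_exp_neg_atTop_nhds_zero.comp h1).const_mul
      (2 * K * Real.exp m * I / (2 * r))
    simpa using this
  filter_upwards [eventually_ge_atTop 1, hlim.eventually_lt_const (half_pos hη)] with k hk hsmall
  have hi := hint k hk
  have hG : 2 * r * Real.exp (-(k * (m / 2))) ≤ ∫ y, Real.exp (-(k * f y)) := by
    calc 2 * r * Real.exp (-(k * (m / 2)))
        = ∫ y in Metric.ball y0 r, Real.exp (-(k * (m / 2))) := by
          simp [Real.volume_real_ball hr.le]
      _ ≤ ∫ y in Metric.ball y0 r, Real.exp (-(k * f y)) := by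
          refine setIntegral_mono_on (integrableOn_const measure_ball_lt_top.ne) hi.integrableOn
            measurableSet_ball fun y hy => ?_
          have h := hfr y hy
          rw [h0, Real.dist_eq, sub_zero] at h
          have := (le_abs_self _).trans h.le
          rw [Real.exp_le_exp]
          nlinarith
      _ ≤ _ := setIntegral_le_integral hi (Eventually.of_forall fun y => (Real.exp_pos _).le)
  set G := ∫ y, Real.exp (-(k * f y)) with hGdef
  have hGpos : 0 < G := lt_of_lt_of_le (by positivity) hG
  have hVi : Integrable (fun y => V y * Real.exp (-(k * f y))) :=
    hi.bdd_mul (c := K) hV.aestronglyMeasurable (Eventually.of_forall hK)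
  have hdiff : (∫ y, V y * Real.exp (-(k * f y))) - V y0 * G
      = ∫ y, (V y - V y0) * Real.exp (-(k * f y)) := by
    rw [hGdef, ← integral_const_mul, ← integral_sub hVi (hi.const_mul _)]
    simp only [sub_mul]
  have hbound : |(∫ y, V y * Real.exp (-(k * f y))) - V y0 * G|
      ≤ η / 2 * G + 2 * K * Real.exp (-((k - 1) * m)) * I := by
    rw [hdiff, hGdef, hI, ← integral_const_mul, ← integral_const_mul,
      ← integral_add (hi.const_mul _) (hint1.const_mul _)]
    rw [← Real.norm_eq_abs]
    refine norm_integral_le_of_norm_le ((hi.const_mul (η / 2)).add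
      (hint1.const_mul (2 * K * Real.exp (-((k - 1) * m))))) (Eventually.of_forall fun y => ?_)
    rw [Real.norm_eq_abs, abs_mul, abs_of_pos (Real.exp_pos _)]
    rcases lt_or_ge |y - y0| δ with h | h
    · have h2 := (hVδ y h).le
      rw [Real.dist_eq] at h2
      have : 0 ≤ 2 * K * Real.exp (-((k - 1) * m)) * Real.exp (-(f y)) := by positivity
      have := mul_le_mul_of_nonneg_right h2 (Real.exp_pos (-(k * f y))).le
      linarith
    · have h2 : |V y - V y0| ≤ 2 * K := by
        have := abs_sub (V y) (V y0)
        linarith [hK y, hK y0]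
      have h3 : Real.exp (-(k * f y)) ≤ Real.exp (-((k - 1) * m)) * Real.exp (-(f y)) := by
        rw [← Real.exp_add, Real.exp_le_exp]
        nlinarith [hmf y h]
      have h4 := mul_le_mul h2 h3 (Real.exp_pos _).le (by positivity)
      have : 0 ≤ η / 2 * Real.exp (-(k * f y)) := by positivity
      linarith
  have hsm : 2 * K * Real.exp (-((k - 1) * m)) * I < η / 2 * G := by
    have e : Real.exp (-((k - 1) * m))
        = Real.exp m * Real.exp (-(k * (m / 2))) * Real.exp (-(k * (m / 2))) := by
      rw [← Real.exp_add, ← Real.exp_add]; ring_nf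
    rw [e]
    have h5 : 2 * K * (Real.exp m * Real.exp (-(k * (m / 2))) * Real.exp (-(k * (m / 2)))) * I
        = (2 * K * Real.exp m * I / (2 * r) * Real.exp (-(k * (m / 2))))
          * (2 * r * Real.exp (-(k * (m / 2)))) := by
      field_simp
    rw [h5]
    refine lt_of_lt_of_le (mul_lt_mul_of_pos_right hsmall (by positivity)) ?_
    exact mul_le_mul_of_nonneg_left hG (by positivity)
  rw [Real.dist_eq]
  have : (∫ y, V y * Real.exp (-(k * f y))) / G - V y0
      = ((∫ y, V y * Real.exp (-(k * f y))) - V y0 * G) / G := by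
    field_simp
  rw [this, abs_div, abs_of_pos hGpos, div_lt_iff₀ hGpos]
  linarith

lemma tauChange_pos (α t : ℝ) (hα : α ≠ 0) (ht : 0 < t) : 0 < tauChange α t := by
  unfold tauChange
  rcases lt_or_gt_of_ne hα with h | h
  · refine div_pos_of_neg_of_neg ?_ h
    have : 1 < Real.exp (-α * t) := Real.one_lt_exp_iff.2 (by nlinarith)
    linarith
  · refine div_pos ?_ h
    have : Real.exp (-α * t) < 1 := by
      rw [← Real.exp_zero, Real.exp_lt_exp]
      nlinarith
    linarith

/-- **vanishing viscosity limit of `V^ε`.**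
If `y ↦ θ(x, y, τ(t))` has a unique global minimizer `y0`, then
`V^ε(x, t) → ∫_0^{y0} v0(s) ds` as `ε → 0⁺`. -/
theorem VVisc_vanishing_viscosity_limit
    (α : ℝ) (hα : α ≠ 0) (u0 : ℝ → ℝ) (hu0m : Measurable u0)
    (hu0b : ∃ M, ∀ y, |u0 y| ≤ M)
    (v0 : ℝ → ℝ) (hv0 : Integrable v0 (volume : Measure ℝ))
    (x t : ℝ) (ht : 0 < t) (y0 : ℝ)
    (hmin : ∀ y : ℝ, thetaFn u0 x y0 (tauChange α t) ≤ thetaFn u0 x y (tauChange α t))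
    (huniq : ∀ y : ℝ, (∀ z : ℝ, thetaFn u0 x y (tauChange α t) ≤ thetaFn u0 x z (tauChange α t))
      → y = y0) :
    Tendsto (fun ε : ℝ => VVisc α u0 v0 ε x t)
      (nhdsWithin 0 (Set.Ioi 0))
      (nhds (∫ s in (0:ℝ)..y0, v0 s)) := by
  have hτ := tauChange_pos α t hα ht
  unfold VVisc
  generalize tauChange α t = τ at *
  obtain ⟨M, hM⟩ := hu0b
  have hu0i : ∀ a b : ℝ, IntervalIntegrable u0 volume a b := fun a b =>
    (intervalIntegrable_const (c := M)).mono_fun hu0m.aestronglyMeasurable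
      (Eventually.of_forall fun y => (hM y).trans (le_abs_self M))
  have hθc : Continuous (fun y => thetaFn u0 x y τ) := by
    unfold thetaFn
    have := intervalIntegral.continuous_primitive hu0i 0
    fun_prop
  have hVc : Continuous (fun y => ∫ s in (0:ℝ)..y, v0 s) :=
    intervalIntegral.continuous_primitive (fun a b => hv0.intervalIntegrable) 0
  have hVb : ∀ y, |∫ s in (0:ℝ)..y, v0 s| ≤ ∫ s, |v0 s| := fun y => by
    rw [← Real.norm_eq_abs]
    refine (intervalIntegral.norm_integral_le_integral_norm_uIoc).trans ?_
    exact setIntegral_le_integral hv0.norm (Eventually.of_forall fun y => norm_nonneg _)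
  have hθlow : ∀ y, 1 / (8 * τ) * y ^ 2 - (x ^ 2 / (2 * τ) + 2 * τ * M ^ 2) ≤ thetaFn u0 x y τ := by
    intro y
    have h1 : |∫ s in (0:ℝ)..y, u0 s| ≤ M * |y - 0| := by
      rw [← Real.norm_eq_abs]
      exact intervalIntegral.norm_integral_le_of_norm_le_const fun s _ => hM s
    rw [sub_zero] at h1
    have h2 := neg_le_of_abs_le h1
    unfold thetaFn
    have h3 : 0 ≤ (|y| - 4 * τ * M) ^ 2 / (8 * τ) + (y - 2 * x) ^ 2 / (4 * τ) := by positivity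
    have h4 : (|y| - 4 * τ * M) ^ 2 / (8 * τ) + (y - 2 * x) ^ 2 / (4 * τ)
        = (x - y) ^ 2 / (2 * τ) - M * |y| - (1 / (8 * τ) * y ^ 2 - (x ^ 2 / (2 * τ) + 2 * τ * M ^ 2)) := by
      have := sq_abs y
      field_simp
      ring_nf
      rw [this]
      ring
    linarith
  have main := aux_laplace (fun y => thetaFn u0 x y τ - thetaFn u0 x y0 τ)
    (fun y => ∫ s in (0:ℝ)..y, v0 s) (by fun_prop) hVc _ hVb y0 (1 / (8 * τ))
    (x ^ 2 / (2 * τ) + 2 * τ * M ^ 2 + thetaFn u0 x y0 τ) (by positivity)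
    (fun y => by have := hθlow y; linarith) (by simp) (fun y hy => by
      by_contra hcon
      exact hy (huniq y fun z => by have := hmin z; linarith))
  have hk : Tendsto (fun ε : ℝ => (1 / 2) * ε⁻¹) (nhdsWithin 0 (Set.Ioi 0)) atTop :=
    tendsto_inv_nhdsGT_zero.const_mul_atTop (by norm_num)
  refine (main.comp hk).congr' ?_
  filter_upwards [self_mem_nhdsWithin] with ε hε
  have hε' : ε ≠ 0 := ne_of_gt hε
  have e : ∀ y, Real.exp (-(1 / 2 * ε⁻¹ * (thetaFn u0 x y τ - thetaFn u0 x y0 τ)))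
      = Real.exp (-(thetaFn u0 x y τ) / (2 * ε)) * Real.exp (thetaFn u0 x y0 τ / (2 * ε)) := by
    intro y
    rw [← Real.exp_add]
    congr 1
    field_simp
    ring
  simp only [Function.comp, e, ← mul_assoc, integral_mul_const]
  rw [mul_div_mul_right _ _ (Real.exp_pos _).ne']
end

section
/- Let α > 0, u0 ∈ L^∞(ℝ) measurable, v0 ∈ L¹(ℝ), and fix ε > 0. Define G(x) = ∫_ℝ exp(−θ(x, y, 1/α)/(2ε)) dy and H(x) = ∫_ℝ V0(y) exp(−θ(x, y, 1/α)/(2ε)) dy. Then, as t → ∞: (i) (−e^{αt}/(2ε)) · u^ε(x, t) converges to G′(x)/G(x), and (ii) V^ε(x, t) converges to H(x)/G(x) and ∂_x V^ε(x, t) converges to (d/dx)(H(x)/G(x)); all these limits are uniform with respect to x on compact subsets of ℝ. -/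
open Real Filter MeasureTheory

/-- `G(x) = ∫_ℝ exp(-θ(x, y, 1/α)/(2ε)) dy`. -/
noncomputable def Gfn (α : ℝ) (u0 : ℝ → ℝ) (ε x : ℝ) : ℝ :=
  ∫ y : ℝ, Real.exp (-(thetaFn u0 x y (1 / α)) / (2 * ε))

/-- `H(x) = ∫_ℝ V0(y) exp(-θ(x, y, 1/α)/(2ε)) dy` with `V0(y) = ∫_0^y v0`. -/
noncomputable def Hfn (α : ℝ) (u0 v0 : ℝ → ℝ) (ε x : ℝ) : ℝ :=
  ∫ y : ℝ, (∫ s in (0:ℝ)..y, v0 s) * Real.exp (-(thetaFn u0 x y (1 / α)) / (2 * ε))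

/-- The basic weighted Gaussian integral. -/
noncomputable def gaussInt (p : ℝ → ℝ) (k : ℕ) (c x : ℝ) : ℝ :=
  ∫ y : ℝ, p y * (x - y) ^ k * Real.exp (-c * (x - y) ^ 2)

theorem gauss_bound (p : ℝ → ℝ) (C B : ℝ) (hC : 0 ≤ C)
    (hp : ∀ y, |p y| ≤ C * Real.exp (B * |y|)) (a R : ℝ) (ha : 0 < a)
    (k : ℕ) (hk : k ≤ 1) (c x y : ℝ) (hc : a ≤ c) (hx : |x| ≤ R) :
    ‖p y * (x - y) ^ k * Real.exp (-c * (x - y) ^ 2)‖ ≤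
      C * Real.exp (R + a * R ^ 2 + (B + 1) ^ 2 / a) * Real.exp (-(a / 4) * y ^ 2) := by
  have hR : 0 ≤ R := (abs_nonneg x).trans hx
  have h1 : |x - y| ^ k ≤ Real.exp (R + |y|) := by
    have h2 : |x - y| ≤ R + |y| := (abs_sub x y).trans (by linarith)
    have h3 := Real.add_one_le_exp (R + |y|)
    have h4 := abs_nonneg y
    interval_cases k
    · simp; linarith
    · simp; linarith
  rw [Real.norm_eq_abs, abs_mul, abs_mul, abs_pow, abs_of_pos (Real.exp_pos _)]
  have h5 : C * Real.exp (R + a * R ^ 2 + (B + 1) ^ 2 / a) * Real.exp (-(a / 4) * y ^ 2)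
      = C * Real.exp (R + a * R ^ 2 + (B + 1) ^ 2 / a -(a / 4) * y ^ 2) := by
    rw [mul_assoc, ← Real.exp_add]; ring_nf
  rw [h5]
  calc |p y| * |x - y| ^ k * Real.exp (-c * (x - y) ^ 2)
      ≤ (C * Real.exp (B * |y|)) * Real.exp (R + |y|) * Real.exp (-c * (x - y) ^ 2) := by
        gcongr
        exact hp y
    _ = C * Real.exp (B * |y| + (R + |y|) + -c * (x - y) ^ 2) := by
        rw [Real.exp_add (B * |y| + (R + |y|)), Real.exp_add (B * |y|)]; ring
    _ ≤ _ := by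
        gcongr
        have h6 : a * (x - y) ^ 2 ≤ c * (x - y) ^ 2 := by gcongr
        have h7 : x ^ 2 ≤ R ^ 2 := sq_le_sq' (by linarith [abs_le.1 hx]) (abs_le.1 hx).2
        have h8 : y ^ 2 / 2 - R ^ 2 ≤ (x - y) ^ 2 := by nlinarith [sq_nonneg (2 * x - y)]
        have h9 : a * (y ^ 2 / 2 - R ^ 2) ≤ a * (x - y) ^ 2 := by gcongr
        have h10 : (B + 1) * |y| ≤ a / 4 * y ^ 2 + (B + 1) ^ 2 / a := by
          rw [← sq_abs y]
          have : a / 4 * |y| ^ 2 + (B + 1) ^ 2 / a - (B + 1) * |y|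
            = (a * |y| / 2 - (B + 1)) ^ 2 / a := by field_simp; ring
          have : 0 ≤ (a * |y| / 2 - (B + 1)) ^ 2 / a := by positivity
          linarith
        linarith

theorem gauss_int (p : ℝ → ℝ) (hpc : Continuous p) (C B : ℝ) (hC : 0 ≤ C)
    (hp : ∀ y, |p y| ≤ C * Real.exp (B * |y|)) (k : ℕ) (hk : k ≤ 1) (c x : ℝ) (hc : 0 < c) :
    Integrable (fun y => p y * (x - y) ^ k * Real.exp (-c * (x - y) ^ 2)) := by
  refine Integrable.mono' ((integrable_exp_neg_mul_sq (b := c / 4) (by positivity)).const_mul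
    (C * Real.exp (|x| + c * |x| ^ 2 + (B + 1) ^ 2 / c))) ?_ ?_
  · exact (by fun_prop : Continuous _).aestronglyMeasurable
  · exact Eventually.of_forall fun y => gauss_bound p C B hC hp c |x| hc k hk c x y le_rfl le_rfl

theorem gauss_cont (p : ℝ → ℝ) (hpc : Continuous p) (C B : ℝ) (hC : 0 ≤ C)
    (hp : ∀ y, |p y| ≤ C * Real.exp (B * |y|)) (k : ℕ) (hk : k ≤ 1) :
    ContinuousOn (fun q : ℝ × ℝ => gaussInt p k q.1 q.2) (Set.Ioi 0 ×ˢ Set.univ) := by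
  rintro ⟨c, x⟩ ⟨hc, -⟩
  have hc : 0 < c := hc
  apply ContinuousAt.continuousWithinAt
  unfold gaussInt
  refine continuousAt_of_dominated (bound := fun y =>
    C * Real.exp ((|x| + 1) + (c / 2) * (|x| + 1) ^ 2 + (B + 1) ^ 2 / (c / 2))
      * Real.exp (-((c / 2) / 4) * y ^ 2)) ?_ ?_ ?_ ?_
  · exact Eventually.of_forall fun q => (by fun_prop : Continuous _).aestronglyMeasurable
  · have h1 : ∀ᶠ q : ℝ × ℝ in nhds (c, x), c / 2 < q.1 :=
      continuous_fst.continuousAt.eventually (lt_mem_nhds (by simp; linarith))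
    have h2 : ∀ᶠ q : ℝ × ℝ in nhds (c, x), |q.2| < |x| + 1 :=
      (continuous_snd.abs).continuousAt.eventually (gt_mem_nhds (by simp))
    filter_upwards [h1, h2] with q hq1 hq2
    exact Eventually.of_forall fun y => gauss_bound p C B hC hp (c / 2) (|x| + 1) (by positivity)
      k hk q.1 q.2 y hq1.le hq2.le
  · exact (integrable_exp_neg_mul_sq (b := c / 2 / 4) (by positivity)).const_mul _
  · exact Eventually.of_forall fun y => by fun_prop

theorem gauss_deriv (p : ℝ → ℝ) (hpc : Continuous p) (C B : ℝ) (hC : 0 ≤ C)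
    (hp : ∀ y, |p y| ≤ C * Real.exp (B * |y|)) (c x : ℝ) (hc : 0 < c) :
    HasDerivAt (fun x => gaussInt p 0 c x) (-2 * c * gaussInt p 1 c x) x := by
  have key := hasDerivAt_integral_of_dominated_loc_of_deriv_le (μ := volume) (𝕜 := ℝ)
    (F := fun x y => p y * (x - y) ^ 0 * Real.exp (-c * (x - y) ^ 2))
    (F' := fun x y => (-2 * c) * (p y * (x - y) ^ 1 * Real.exp (-c * (x - y) ^ 2)))
    (x₀ := x) (s := Metric.ball x 1) (bound := fun y => |-2 * c| * 
    (C * Real.exp ((|x| + 1) + c * (|x| + 1) ^ 2 + (B + 1) ^ 2 / c)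
      * Real.exp (-(c / 4) * y ^ 2))) (Metric.ball_mem_nhds x one_pos)
      (Eventually.of_forall fun q => (by fun_prop : Continuous _).aestronglyMeasurable)
      (gauss_int p hpc C B hC hp 0 (by norm_num) c x hc)
      ((by fun_prop : Continuous _).aestronglyMeasurable) ?_ ?_ ?_
  · have := key.2
    rw [integral_const_mul] at this
    exact this
  · refine Eventually.of_forall fun y z hz => ?_
    rw [norm_mul, Real.norm_eq_abs (-2 * c)]
    gcongr
    refine gauss_bound p C B hC hp c (|x| + 1) hc 1 le_rfl c z y le_rfl ?_
    have h := abs_sub_abs_le_abs_sub z x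
    rw [Metric.mem_ball, Real.dist_eq] at hz
    linarith
  · exact ((integrable_exp_neg_mul_sq (b := c / 4) (by positivity)).const_mul _).const_mul _
  · refine Eventually.of_forall fun y z hz => ?_
    have h1 : HasDerivAt (fun x : ℝ => -c * (x - y) ^ 2) (-c * (2 * (z - y))) z := by
      have := (((hasDerivAt_id z).sub_const y).pow 2).const_mul (-c)
      simpa using this
    have h2 := (h1.exp.const_mul (p y * 1))
    simp only [pow_zero]
    exact h2.congr_deriv (by ring)

theorem gauss_pos (p : ℝ → ℝ) (hpc : Continuous p) (C B : ℝ) (hC : 0 ≤ C)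
    (hp : ∀ y, |p y| ≤ C * Real.exp (B * |y|)) (hpos : ∀ y, 0 < p y) (c x : ℝ) (hc : 0 < c) :
    0 < gaussInt p 0 c x := by
  have hint := gauss_int p hpc C B hC hp 0 (by norm_num) c x hc
  have hh : ∀ y, 0 < p y * (x - y) ^ 0 * Real.exp (-c * (x - y) ^ 2) := fun y => by
    have := hpos y
    positivity
  unfold gaussInt
  rw [integral_pos_iff_support_of_nonneg (fun y => (hh y).le) hint]
  have : Function.support (fun y => p y * (x - y) ^ 0 * Real.exp (-c * (x - y) ^ 2)) = Set.univ :=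
    Set.eq_univ_of_forall fun y => (hh y).ne'
  rw [this]; simp

theorem unif_of_cont (F : ℝ × ℝ → ℝ) (hF : ContinuousOn F (Set.Ioi 0 ×ˢ Set.univ))
    (cf : ℝ → ℝ) (c0 : ℝ) (hc0 : 0 < c0) (hcf : Tendsto cf atTop (nhds c0))
    (K : Set ℝ) (hK : IsCompact K) :
    TendstoUniformlyOn (fun t x => F (cf t, x)) (fun x => F (c0, x)) atTop K := by
  have hF' : ContinuousOn (Function.uncurry fun c x => F (c, x)) (Set.Ioi 0 ×ˢ K) :=
    hF.mono (Set.prod_mono le_rfl (Set.subset_univ _))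
  intro u hu
  obtain ⟨v, hv, hvu⟩ := hK.mem_uniformity_of_prod hF' (Set.mem_Ioi.2 hc0) (symm_le_uniformity hu)
  rw [nhdsWithin_eq_nhds.2 (Ioi_mem_nhds hc0)] at hv
  filter_upwards [hcf hv] with t ht x hx
  exact hvu _ ht x hx

theorem prim_bound (u0 : ℝ → ℝ) (M : ℝ) (hM : ∀ y, |u0 y| ≤ M) (y : ℝ) :
    |∫ s in (0:ℝ)..y, u0 s| ≤ M * |y| := by
  have := intervalIntegral.norm_integral_le_of_norm_le_const (a := 0) (b := y) (f := u0) (C := M)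
    (fun z _ => hM z)
  simpa using this

theorem theta_split (u0 : ℝ → ℝ) (ε x y τ : ℝ) :
    Real.exp (-(thetaFn u0 x y τ) / (2 * ε)) =
      Real.exp (-(∫ s in (0:ℝ)..y, u0 s) / (2 * ε)) *
        Real.exp (-(1 / (4 * ε * τ)) * (x - y) ^ 2) := by
  rw [← Real.exp_add, thetaFn]
  congr 1
  have : (x - y) ^ 2 / (2 * τ) / (2 * ε) = (1 / (4 * ε * τ)) * (x - y) ^ 2 := by
    rw [div_div, show 2 * τ * (2 * ε) = 4 * ε * τ by ring]; ring
  rw [neg_div, add_div, this]; ring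

/-- **large time behaviour, case `α > 0`.**
As `t → ∞`, `(-e^{αt}/(2ε)) u^ε(x,t) → G'(x)/G(x)`, `V^ε(x,t) → H(x)/G(x)` and
`∂_x V^ε(x,t) → (H/G)'(x)`, uniformly with respect to `x` on compact subsets of `ℝ`. -/
theorem large_time_asymptotics_alpha_pos
    (α : ℝ) (hα : 0 < α) (u0 : ℝ → ℝ) (hu0m : Measurable u0)
    (hu0b : ∃ M, ∀ y, |u0 y| ≤ M)
    (v0 : ℝ → ℝ) (hv0 : Integrable v0 (volume : Measure ℝ))
    (ε : ℝ) (hε : 0 < ε) :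
    ∀ K : Set ℝ, IsCompact K →
      TendstoUniformlyOn
        (fun t x => (-(Real.exp (α * t)) / (2 * ε)) * uVisc α u0 ε x t)
        (fun x => deriv (Gfn α u0 ε) x / Gfn α u0 ε x) atTop K
      ∧ TendstoUniformlyOn
        (fun t x => VVisc α u0 v0 ε x t)
        (fun x => Hfn α u0 v0 ε x / Gfn α u0 ε x) atTop K
      ∧ TendstoUniformlyOn
        (fun t x => deriv (fun x' => VVisc α u0 v0 ε x' t) x)
        (fun x => deriv (fun x' => Hfn α u0 v0 ε x' / Gfn α u0 ε x') x) atTop K := by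
  intro K hK
  obtain ⟨M, hM⟩ := hu0b
  have hu0i : ∀ a b : ℝ, IntervalIntegrable u0 volume a b := fun a b => by
    refine (intervalIntegrable_const (c := M)).mono_fun hu0m.aestronglyMeasurable ?_
    refine Eventually.of_forall fun y => ?_
    change |u0 y| ≤ |M|
    exact (hM y).trans (le_abs_self M)
  have hUc : Continuous fun y => ∫ s in (0:ℝ)..y, u0 s :=
    intervalIntegral.continuous_primitive hu0i 0
  have hVc : Continuous fun y => ∫ s in (0:ℝ)..y, v0 s :=
    intervalIntegral.continuous_primitive (fun a b => hv0.intervalIntegrable) 0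
  set p : ℝ → ℝ := fun y => Real.exp (-(∫ s in (0:ℝ)..y, u0 s) / (2 * ε)) with hpdef
  set q : ℝ → ℝ := fun y => (∫ s in (0:ℝ)..y, v0 s) * p y with hqdef
  have hpc : Continuous p := by fun_prop
  have hqc : Continuous q := hVc.mul hpc
  set B := M / (2 * ε) with hB
  have hpe : ∀ y, p y ≤ Real.exp (B * |y|) := fun y => by
    apply Real.exp_le_exp.2
    have h := (abs_le.1 (prim_bound u0 M hM y)).1
    rw [hB, div_mul_eq_mul_div]
    gcongr
    linarith
  have hpp : ∀ y, 0 < p y := fun y => Real.exp_pos _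
  have hpb : ∀ y, |p y| ≤ 1 * Real.exp (B * |y|) := fun y => by
    rw [abs_of_pos (hpp y), one_mul]; exact hpe y
  set C := ∫ s, ‖v0 s‖ with hCdef
  have hC : 0 ≤ C := integral_nonneg fun s => norm_nonneg _
  have hVb : ∀ y, |∫ s in (0:ℝ)..y, v0 s| ≤ C := fun y => by
    have h := intervalIntegral.norm_integral_le_integral_norm_uIoc (a := 0) (b := y) (f := v0)
      (μ := volume)
    exact h.trans (setIntegral_le_integral hv0.norm (Eventually.of_forall fun s => norm_nonneg _))
  have hqb : ∀ y, |q y| ≤ C * Real.exp (B * |y|) := fun y => by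
    rw [hqdef]
    simp only [abs_mul, abs_of_pos (hpp y)]
    exact mul_le_mul (hVb y) (hpe y) (hpp y).le hC
  -- the rewriting of all quantities
  have hG : ∀ x τ : ℝ, (∫ y : ℝ, Real.exp (-(thetaFn u0 x y τ) / (2 * ε))) =
      gaussInt p 0 (1 / (4 * ε * τ)) x := fun x τ => by
    unfold gaussInt
    congr 1; ext y; rw [theta_split]; simp [hpdef]
  have hH : ∀ x τ : ℝ, (∫ y : ℝ, (∫ s in (0:ℝ)..y, v0 s) *
      Real.exp (-(thetaFn u0 x y τ) / (2 * ε))) = gaussInt q 0 (1 / (4 * ε * τ)) x := fun x τ => by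
    unfold gaussInt
    congr 1; ext y; rw [theta_split]; simp [hqdef, hpdef, mul_assoc]
  have hN : ∀ x τ : ℝ, (∫ y : ℝ, ((x - y) / τ) *
      Real.exp (-(thetaFn u0 x y τ) / (2 * ε))) =
        1 / τ * gaussInt p 1 (1 / (4 * ε * τ)) x := fun x τ => by
    unfold gaussInt
    rw [← integral_const_mul]
    congr 1; ext y; rw [theta_split]; simp only [hpdef]; ring
  set cf : ℝ → ℝ := fun t => 1 / (4 * ε * tauChange α t) with hcf
  set c0 : ℝ := 1 / (4 * ε * (1 / α)) with hc0
  have hc0p : 0 < c0 := by positivity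
  have hτ : ∀ t, 0 < t → 0 < tauChange α t := fun t ht => by
    have : Real.exp (-α * t) < 1 := by
      rw [Real.exp_lt_one_iff]
      nlinarith
    exact div_pos (by linarith) hα
  have hcfp : ∀ t, 0 < t → 0 < cf t := fun t ht => by
    have := hτ t ht
    simp only [hcf]; positivity
  have hτl : Tendsto (fun t => tauChange α t) atTop (nhds (1 / α)) := by
    have h1 : Tendsto (fun t : ℝ => Real.exp (-α * t)) atTop (nhds 0) :=
      Real.tendsto_exp_atBot.comp (tendsto_id.const_mul_atTop_of_neg (by linarith))
    have := (h1.const_sub 1).div_const α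
    simpa [tauChange] using this
  have hcfl : Tendsto cf atTop (nhds c0) :=
    Tendsto.div tendsto_const_nhds (hτl.const_mul _) (by positivity)
  have hGf : Gfn α u0 ε = fun x => gaussInt p 0 c0 x := by
    ext x; exact hG x (1 / α)
  have hHf : Hfn α u0 v0 ε = fun x => gaussInt q 0 c0 x := by
    ext x; exact hH x (1 / α)
  have hVf : ∀ x t, VVisc α u0 v0 ε x t = gaussInt q 0 (cf t) x / gaussInt p 0 (cf t) x :=
    fun x t => by rw [VVisc, hG, hH]
  have cp0 := gauss_cont p hpc 1 B zero_le_one hpb 0 (by norm_num)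
  have cp1 := gauss_cont p hpc 1 B zero_le_one hpb 1 le_rfl
  have cq0 := gauss_cont q hqc C B hC hqb 0 (by norm_num)
  have cq1 := gauss_cont q hqc C B hC hqb 1 le_rfl
  have pos : ∀ c x, 0 < c → gaussInt p 0 c x ≠ 0 := fun c x hc =>
    (gauss_pos p hpc 1 B zero_le_one hpb hpp c x hc).ne'
  have dp := gauss_deriv p hpc 1 B zero_le_one hpb
  have dq := gauss_deriv q hqc C B hC hqb
  have pos' : ∀ z ∈ (Set.Ioi (0:ℝ) ×ˢ (Set.univ : Set ℝ)), gaussInt p 0 z.1 z.2 ≠ 0 :=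
    fun z hz => pos _ _ hz.1
  have ddiv : ∀ c x, 0 < c → deriv (fun x => gaussInt q 0 c x / gaussInt p 0 c x) x =
      ((-2 * c * gaussInt q 1 c x) * gaussInt p 0 c x
        - gaussInt q 0 c x * (-2 * c * gaussInt p 1 c x)) / gaussInt p 0 c x ^ 2 :=
    fun c x hc => ((dq c x hc).div (dp c x hc) (pos c x hc)).deriv
  refine ⟨?_, ?_, ?_⟩
  · have h := unif_of_cont (fun z => -2 * z.1 * gaussInt p 1 z.1 z.2 / gaussInt p 0 z.1 z.2)
      (((continuousOn_const.mul continuousOn_fst).mul cp1).div cp0 pos') cf c0 hc0p hcfl K hK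
    refine (h.congr ?_).congr_right ?_
    · filter_upwards [eventually_gt_atTop 0] with t ht x hx
      have h1 := hτ t ht
      have h2 : Real.exp (α * t) * Real.exp (-α * t) = 1 := by
        rw [← Real.exp_add]; simp
      simp only [uVisc]
      rw [hG, hN]
      change -2 * cf t * gaussInt p 1 (cf t) x / gaussInt p 0 (cf t) x =
        -Real.exp (α * t) / (2 * ε) * (Real.exp (-α * t) * (1 / tauChange α t *
          gaussInt p 1 (cf t) x) / gaussInt p 0 (cf t) x)
      have h3 : -2 * cf t = -(1 / (2 * ε) * (1 / tauChange α t)) := by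
        simp only [hcf]; field_simp; norm_num
      rw [h3]
      linear_combination (1 / (2 * ε) * (1 / tauChange α t) * gaussInt p 1 (cf t) x / 
        gaussInt p 0 (cf t) x) * h2
    · intro x hx
      simp only [hGf]
      rw [(dp c0 x hc0p).deriv]
  · have h := unif_of_cont (fun z => gaussInt q 0 z.1 z.2 / gaussInt p 0 z.1 z.2)
      (cq0.div cp0 pos') cf c0 hc0p hcfl K hK
    simp only [hVf, hGf, hHf]
    exact h
  · have h := unif_of_cont (fun z => ((-2 * z.1 * gaussInt q 1 z.1 z.2) * gaussInt p 0 z.1 z.2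
        - gaussInt q 0 z.1 z.2 * (-2 * z.1 * gaussInt p 1 z.1 z.2)) / gaussInt p 0 z.1 z.2 ^ 2)
      ((((((continuousOn_const.mul continuousOn_fst).mul cq1).mul cp0).sub
        (cq0.mul ((continuousOn_const.mul continuousOn_fst).mul cp1)))).div (cp0.pow 2)
        (fun z hz => pow_ne_zero 2 (pos' z hz))) cf c0 hc0p hcfl K hK
    simp only [hVf, hGf, hHf]
    refine (h.congr ?_).congr_right ?_
    · filter_upwards [eventually_gt_atTop 0] with t ht x hx
      exact (ddiv (cf t) x (hcfp t ht)).symm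
    · intro x hx
      exact (ddiv c0 x hc0p).symm
end

section
/- Let ε > 0. Let φ : ℝ → ℝ be a bounded continuous function having finite limits φ(+∞) = lim_{s→+∞} φ(s) and φ(−∞) = lim_{s→−∞} φ(s), and let U0 : ℝ → ℝ be a bounded continuous function having finite limits U0(+∞) and U0(−∞). For ξ ∈ ℝ and τ > 0 define Φ(ξ, τ) = (2π)^{−1/2} ∫_ℝ φ(√(2ετ)(ξ − y)) · exp(−U0(√(2ετ)(ξ − y))/(2ε)) · e^{−y²/2} dy. Then, as τ → ∞, Φ(ξ, τ) converges to (2π)^{−1/2} [ e^{−U0(+∞)/(2ε)} φ(+∞) ∫_{−∞}^{ξ} e^{−y²/2} dy + e^{−U0(−∞)/(2ε)} φ(−∞) ∫_{ξ}^{∞} e^{−y²/2} dy ], uniformly with respect to ξ on compact subsets of ℝ. -/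
open Real Filter MeasureTheory

/-- Dominated convergence for the rescaled difference. -/
lemma hopf_aux_dct (ε : ℝ) (hε : 0 < ε) (g : ℝ → ℝ) (hgm : Measurable g) (C : ℝ)
    (hC : ∀ s, |g s| ≤ C) (hp : Tendsto g atTop (nhds 0)) (hm : Tendsto g atBot (nhds 0)) :
    Tendsto (fun τ : ℝ => ∫ u : ℝ, |g (Real.sqrt (2 * ε * τ) * u)| * Real.exp (-(1 / 4) * u ^ 2))
      atTop (nhds 0) := by
  have hc : Tendsto (fun τ : ℝ => Real.sqrt (2 * ε * τ)) atTop atTop :=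
    Real.tendsto_sqrt_atTop.comp (tendsto_id.const_mul_atTop (by positivity))
  have key := tendsto_integral_filter_of_dominated_convergence (μ := volume) (l := atTop)
    (F := fun (τ : ℝ) (u : ℝ) => |g (Real.sqrt (2 * ε * τ) * u)| * Real.exp (-(1 / 4) * u ^ 2))
    (f := fun _ => (0 : ℝ))
    (fun u => C * Real.exp (-(1 / 4) * u ^ 2)) ?_ ?_ ?_ ?_
  · simpa using key
  · refine Eventually.of_forall fun τ => Measurable.aestronglyMeasurable ?_
    have : Measurable fun u : ℝ => g (Real.sqrt (2 * ε * τ) * u) :=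
      hgm.comp (measurable_const_mul _)
    have h2 : Measurable fun u : ℝ => |g (Real.sqrt (2 * ε * τ) * u)| := this.norm
    exact h2.mul (by fun_prop)
  · refine Eventually.of_forall fun τ => Eventually.of_forall fun u => ?_
    rw [Real.norm_eq_abs, abs_mul, abs_abs, abs_of_pos (Real.exp_pos _)]
    exact mul_le_mul_of_nonneg_right (hC _) (Real.exp_pos _).le
  · exact (integrable_exp_neg_mul_sq (by norm_num)).const_mul C
  · have h0 : ∀ᵐ u : ℝ, u ≠ 0 := by
      simp [ae_iff, measure_singleton]
    filter_upwards [h0] with u hu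
    have h1 : Tendsto (fun τ : ℝ => g (Real.sqrt (2 * ε * τ) * u)) atTop (nhds 0) := by
      rcases lt_or_gt_of_ne hu with h | h
      · exact hm.comp (hc.atTop_mul_const_of_neg h)
      · exact hp.comp (hc.atTop_mul_const h)
    have h2 := h1.abs.mul_const (Real.exp (-(1 / 4) * u ^ 2))
    rw [abs_zero, zero_mul] at h2
    exact h2

/-- Uniform limit for a general bounded measurable profile. -/
lemma hopf_aux (ε : ℝ) (hε : 0 < ε) (h : ℝ → ℝ) (hh : Measurable h) (C : ℝ)
    (hC : ∀ s, |h s| ≤ C) (p m : ℝ)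
    (hp : Tendsto h atTop (nhds p)) (hm : Tendsto h atBot (nhds m)) (K : Set ℝ)
    (hK : IsCompact K) :
    TendstoUniformlyOn
      (fun τ ξ => ∫ y : ℝ, h (Real.sqrt (2 * ε * τ) * (ξ - y)) * Real.exp (-y ^ 2 / 2))
      (fun ξ => p * (∫ y in Set.Iic ξ, Real.exp (-y ^ 2 / 2)) +
        m * (∫ y in Set.Ici ξ, Real.exp (-y ^ 2 / 2))) atTop K := by
  set H : ℝ → ℝ := fun s => if 0 ≤ s then p else m with hH
  have hHm : Measurable H := Measurable.ite measurableSet_Ici measurable_const measurable_const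
  have hHb : ∀ s, |H s| ≤ |p| + |m| := by
    intro s
    simp only [hH]
    split_ifs <;> linarith [abs_nonneg p, abs_nonneg m]
  have hg : Measurable (fun s => h s - H s) := hh.sub hHm
  have hgb : ∀ s, |h s - H s| ≤ C + (|p| + |m|) := fun s =>
    (abs_sub _ _).trans (add_le_add (hC s) (hHb s))
  have hgp : Tendsto (fun s => h s - H s) atTop (nhds 0) := by
    have : Tendsto (fun s => h s - p) atTop (nhds 0) := by simpa using hp.sub_const p
    refine this.congr' ?_
    filter_upwards [eventually_ge_atTop 0] with s hs
    simp [hH, hs]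
  have hgm : Tendsto (fun s => h s - H s) atBot (nhds 0) := by
    have : Tendsto (fun s => h s - m) atBot (nhds 0) := by simpa using hm.sub_const m
    refine this.congr' ?_
    filter_upwards [eventually_lt_atBot 0] with s hs
    simp [hH, not_le.mpr hs]
  have hlim := hopf_aux_dct ε hε _ hg _ hgb hgp hgm
  obtain ⟨R, hR⟩ := hK.isBounded.exists_norm_le
  have hlim2 := hlim.const_mul (Real.exp (R ^ 2 / 2))
  rw [mul_zero] at hlim2
  have hE : Integrable (fun y : ℝ => Real.exp (-y ^ 2 / 2)) := by
    have := integrable_exp_neg_mul_sq (b := 1 / 2) (by norm_num)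
    refine this.congr (Eventually.of_forall fun y => ?_)
    simp only
    congr 1
    ring
  have hint : ∀ (f : ℝ → ℝ) (D : ℝ), Measurable f → (∀ s, |f s| ≤ D) → ∀ c ξ : ℝ,
      Integrable (fun y : ℝ => f (c * (ξ - y)) * Real.exp (-y ^ 2 / 2)) := by
    intro f D hf hD c ξ
    refine hE.bdd_mul (c := D) ?_ (Eventually.of_forall fun y => hD _)
    have : Measurable fun y : ℝ => c * (ξ - y) := by fun_prop
    exact (hf.comp this).aestronglyMeasurable
  rw [Metric.tendstoUniformlyOn_iff]
  intro δ hδ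
  filter_upwards [hlim2.eventually_lt_const hδ, eventually_gt_atTop 0] with τ hτ hτ0 ξ hξ
  refine lt_of_le_of_lt ?_ hτ
  set c := Real.sqrt (2 * ε * τ) with hc
  have hc0 : 0 < c := Real.sqrt_pos.mpr (by positivity)
  have e1 : p * (∫ y in Set.Iic ξ, Real.exp (-y ^ 2 / 2)) +
        m * (∫ y in Set.Ici ξ, Real.exp (-y ^ 2 / 2)) =
      ∫ y : ℝ, H (c * (ξ - y)) * Real.exp (-y ^ 2 / 2) := by
    rw [← integral_add_compl (measurableSet_Iic (a := ξ)) (hint H _ hHm hHb c ξ),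
      integral_Ici_eq_integral_Ioi, Set.compl_Iic, ← integral_const_mul, ← integral_const_mul]
    congr 1
    · refine setIntegral_congr_fun measurableSet_Iic fun y hy => ?_
      have : 0 ≤ c * (ξ - y) := mul_nonneg hc0.le (sub_nonneg.mpr hy)
      simp [hH, this]
    · refine setIntegral_congr_fun measurableSet_Ioi fun y hy => ?_
      have : c * (ξ - y) < 0 := mul_neg_of_pos_of_neg hc0 (sub_neg.mpr hy)
      simp [hH, not_le.mpr this]
  rw [e1, dist_comm, Real.dist_eq, ← integral_sub (hint h _ hh hC c ξ) (hint H _ hHm hHb c ξ),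
    ← integral_const_mul]
  have e2 := integral_sub_left_eq_self (fun y : ℝ => h (c * (ξ - y)) * Real.exp (-y ^ 2 / 2) -
    H (c * (ξ - y)) * Real.exp (-y ^ 2 / 2)) volume ξ
  rw [← e2, ← Real.norm_eq_abs]
  refine norm_integral_le_of_norm_le ?_ (Eventually.of_forall fun u => ?_)
  · refine Integrable.const_mul ?_ _
    refine (integrable_exp_neg_mul_sq (by norm_num)).bdd_mul (c := C + (|p| + |m|)) ?_
      (Eventually.of_forall fun y => ?_)
    · have : Measurable fun y : ℝ => c * y := by fun_prop
      exact (hg.comp this).norm.aestronglyMeasurable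
    · rw [Real.norm_eq_abs, abs_abs]
      exact hgb _
  · have hx : |ξ| ≤ R := hR ξ hξ
    have hx2 : ξ ^ 2 ≤ R ^ 2 := sq_le_sq' (by linarith [neg_abs_le ξ]) ((le_abs_self ξ).trans hx)
    rw [sub_sub_cancel, ← sub_mul, Real.norm_eq_abs, abs_mul, abs_of_pos (Real.exp_pos _),
      mul_left_comm, ← Real.exp_add]
    refine mul_le_mul_of_nonneg_left (Real.exp_le_exp.mpr ?_) (abs_nonneg _)
    nlinarith [sq_nonneg (2 * ξ - u)]

/-- **Hopf-type large time limit, case `α < 0`.**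
For bounded continuous `φ` and `U0` with finite limits at `±∞`, the function
`Φ(ξ, τ) = (2π)^{-1/2} ∫_ℝ φ(√(2ετ)(ξ - y)) exp(-U0(√(2ετ)(ξ - y))/(2ε)) e^{-y²/2} dy`
converges, as `τ → ∞`, to
`(2π)^{-1/2} [e^{-U0(+∞)/(2ε)} φ(+∞) ∫_{-∞}^{ξ} e^{-y²/2} dy
  + e^{-U0(-∞)/(2ε)} φ(-∞) ∫_{ξ}^{∞} e^{-y²/2} dy]`,
uniformly with respect to `ξ` on compact subsets of `ℝ`. -/
theorem hopf_large_time_limit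
    (ε : ℝ) (hε : 0 < ε)
    (φ U0 : ℝ → ℝ)
    (hφc : Continuous φ) (hφb : ∃ M, ∀ s, |φ s| ≤ M)
    (φp φm : ℝ) (hφp : Tendsto φ atTop (nhds φp)) (hφm : Tendsto φ atBot (nhds φm))
    (hU0c : Continuous U0) (hU0b : ∃ M, ∀ s, |U0 s| ≤ M)
    (U0p U0m : ℝ) (hU0p : Tendsto U0 atTop (nhds U0p)) (hU0m : Tendsto U0 atBot (nhds U0m)) :
    ∀ K : Set ℝ, IsCompact K →
      TendstoUniformlyOn
        (fun τ ξ => (Real.sqrt (2 * Real.pi))⁻¹ *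
          ∫ y : ℝ, φ (Real.sqrt (2 * ε * τ) * (ξ - y)) *
            Real.exp (-(U0 (Real.sqrt (2 * ε * τ) * (ξ - y))) / (2 * ε)) *
            Real.exp (-y ^ 2 / 2))
        (fun ξ => (Real.sqrt (2 * Real.pi))⁻¹ *
          (Real.exp (-U0p / (2 * ε)) * φp * (∫ y in Set.Iic ξ, Real.exp (-y ^ 2 / 2)) +
            Real.exp (-U0m / (2 * ε)) * φm * (∫ y in Set.Ici ξ, Real.exp (-y ^ 2 / 2))))
        atTop K := by
  obtain ⟨A, hA⟩ := hφb
  obtain ⟨B, hB⟩ := hU0b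
  intro K hK
  have hb : ∀ s, |φ s * Real.exp (-(U0 s) / (2 * ε))| ≤ A * Real.exp (B / (2 * ε)) := by
    intro s
    rw [abs_mul, abs_of_pos (Real.exp_pos _)]
    refine mul_le_mul (hA s) (Real.exp_le_exp.mpr ?_) (Real.exp_pos _).le
      ((abs_nonneg _).trans (hA s))
    exact div_le_div_of_nonneg_right ((neg_le_abs _).trans (hB s)) (by positivity)
  have hlim : ∀ (l : Filter ℝ) (a b : ℝ), Tendsto φ l (nhds a) → Tendsto U0 l (nhds b) →
      Tendsto (fun s => φ s * Real.exp (-(U0 s) / (2 * ε))) l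
        (nhds (Real.exp (-b / (2 * ε)) * a)) := by
    intro l a b ha hb
    rw [mul_comm (Real.exp (-b / (2 * ε))) a]
    exact ha.mul ((Real.continuous_exp.tendsto _).comp (hb.neg.div_const _))
  have hmeas : Measurable (fun s => φ s * Real.exp (-(U0 s) / (2 * ε))) := by
    apply Continuous.measurable
    fun_prop
  have key := hopf_aux ε hε _ hmeas _ hb _ _ (hlim _ _ _ hφp hU0p) (hlim _ _ _ hφm hU0m) K hK
  exact (uniformContinuous_const_smul (Real.sqrt (2 * Real.pi))⁻¹).comp_tendstoUniformlyOn key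
end

section
/- Let α ≠ 0 be a real constant and u0 ∈ L^∞(ℝ) measurable. Let y : ℝ × (0, ∞) → ℝ be a measurable function such that for every x ∈ ℝ and t > 0, y(x, t) is a global minimizer of the function z ↦ θ(x, z, τ(t)). Define u(x, t) = e^{−αt} (x − y(x, t))/τ(t). Then u is a distributional solution of the damped Burgers equation with initial data u0: for every φ ∈ C_c^∞(ℝ × [0, ∞)), ∫_0^∞ ∫_ℝ [ u(x,t) ∂_t φ(x,t) + (u(x,t)²/2) ∂_x φ(x,t) − α u(x,t) φ(x,t) ] dx dt + ∫_ℝ u0(x) φ(x, 0) dx = 0. -/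
open Real Filter MeasureTheory

/-- Integration by parts for a Lipschitz function whose derivative is known where it exists. -/
lemma aux_ibp {a b : ℝ} (hab : a ≤ b) (f f' g g' : ℝ → ℝ) (K : ℝ)
    (hf : ∀ x ∈ Set.Icc a b, ∀ z ∈ Set.Icc a b, |f x - f z| ≤ K * |x - z|)
    (hf' : ∀ᵐ x, x ∈ Set.Ioo a b → ∀ d, HasDerivAt f d x → d = f' x)
    (hg : ∀ x, HasDerivAt g (g' x) x) (hg' : Continuous g') :
    ∫ x in a..b, f' x * g x = f b * g b - f a * g a - ∫ x in a..b, f x * g' x := by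
  have hfac : AbsolutelyContinuousOnInterval f a b := by
    apply LipschitzOnWith.absolutelyContinuousOnInterval (K := Real.toNNReal K)
    apply LipschitzOnWith.of_dist_le_mul
    rw [Set.uIcc_of_le hab]
    intro x hx z hz
    rw [Real.dist_eq, Real.dist_eq]
    refine (hf x hx z hz).trans ?_
    gcongr
    exact Real.le_coe_toNNReal K
  have hderiv : deriv g = g' := funext fun x => (hg x).deriv
  have hgc : ContDiff ℝ 1 g := by
    rw [contDiff_one_iff_deriv]
    exact ⟨fun x => (hg x).differentiableAt, hderiv ▸ hg'⟩
  have hgac : AbsolutelyContinuousOnInterval g a b := by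
    obtain ⟨L, hL⟩ := hgc.contDiffOn.exists_lipschitzOnWith (s := Set.Icc a b) (by decide)
      (convex_Icc _ _) isCompact_Icc
    exact LipschitzOnWith.absolutelyContinuousOnInterval (K := L) (by rwa [Set.uIcc_of_le hab])
  have h := hfac.integral_mul_deriv_eq_deriv_mul hgac
  rw [hderiv] at h
  have h2 : ∫ x in a..b, f' x * g x = ∫ x in a..b, deriv f x * g x := by
    apply intervalIntegral.integral_congr_ae
    have hb : ∀ᵐ x : ℝ, x ≠ b := by simp [ae_iff, measure_singleton]
    filter_upwards [hfac.ae_differentiableAt, hb, hf'] with x hx hxb hf' hx3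
    have hx4 := Set.uIoc_subset_uIcc hx3
    rw [Set.uIoc_of_le hab] at hx3
    rw [hf' ⟨hx3.1, lt_of_le_of_ne hx3.2 hxb⟩ _ (hx hx4).hasDerivAt]
  rw [h2, h]; ring

lemma aux_box {a b c d C : ℝ} (hab : a ≤ b) (hcd : c ≤ d) (f : ℝ → ℝ → ℝ)
    (hf : Measurable (fun z : ℝ × ℝ => f z.1 z.2))
    (hC : ∀ s ∈ Set.Ioc a b, ∀ x ∈ Set.Ioc c d, |f s x| ≤ C) :
    Integrable (fun z : ℝ × ℝ => f z.1 z.2)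
      ((volume.restrict (Set.uIoc a b)).prod (volume.restrict (Set.uIoc c d))) := by
  rw [Set.uIoc_of_le hab, Set.uIoc_of_le hcd, Measure.prod_restrict]
  refine Measure.integrableOn_of_bounded (M := C) ?_ hf.aestronglyMeasurable ?_
  · rw [Measure.prod_prod]
    simp [ENNReal.mul_eq_top]
  · filter_upwards [ae_restrict_mem (measurableSet_Ioc.prod measurableSet_Ioc)] with z hz
    exact hC z.1 hz.1 z.2 hz.2

lemma aux_line {c d C : ℝ} (hcd : c ≤ d) (f : ℝ → ℝ)
    (hf : Measurable f) (hC : ∀ x ∈ Set.Ioc c d, |f x| ≤ C) :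
    IntervalIntegrable f volume c d := by
  rw [intervalIntegrable_iff, Set.uIoc_of_le hcd]
  refine Measure.integrableOn_of_bounded (M := C) (by simp) hf.aestronglyMeasurable ?_
  filter_upwards [ae_restrict_mem measurableSet_Ioc] with z hz
  exact hC z hz

lemma aux_outer {a b c d C : ℝ} (hab : a ≤ b) (hcd : c ≤ d) (f : ℝ → ℝ → ℝ)
    (hf : Measurable (fun z : ℝ × ℝ => f z.1 z.2))
    (hC : ∀ s ∈ Set.Ioc a b, ∀ x ∈ Set.Ioc c d, |f s x| ≤ C) :
    IntervalIntegrable (fun s => ∫ x in c..d, f s x) volume a b := by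
  have h := (aux_box hab hcd f hf hC).integral_prod_left
  rw [intervalIntegrable_iff]
  simp only [intervalIntegral.integral_of_le hcd]
  rw [Set.uIoc_of_le hcd] at h
  exact h

lemma aux_core {R : ℝ} (hR : 0 < R) (W p q a b c : ℝ → ℝ → ℝ) (K B : ℝ)
    (hW : Measurable (fun z : ℝ × ℝ => W z.1 z.2))
    (hp : Measurable (fun z : ℝ × ℝ => p z.1 z.2))
    (hq : Measurable (fun z : ℝ × ℝ => q z.1 z.2))
    (ha : Continuous (fun z : ℝ × ℝ => a z.1 z.2))
    (hb : Continuous (fun z : ℝ × ℝ => b z.1 z.2))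
    (hc : Continuous (fun z : ℝ × ℝ => c z.1 z.2))
    (hWB : ∀ x ∈ Set.Icc (-R) R, ∀ t ∈ Set.Icc 0 R, |W x t| ≤ B)
    (hpB : ∀ x ∈ Set.Icc (-R) R, ∀ t ∈ Set.Ioc 0 R, |p x t| ≤ B)
    (hqB : ∀ x ∈ Set.Icc (-R) R, ∀ t ∈ Set.Ioc 0 R, |q x t| ≤ B)
    (hWx : ∀ t ∈ Set.Ioc 0 R, ∀ x z, |W x t - W z t| ≤ K * |x - z|)
    (hWt : ∀ x, ∀ t ∈ Set.Icc 0 R, ∀ s ∈ Set.Icc 0 R, |W x t - W x s| ≤ K * |t - s|)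
    (hWp : ∀ t ∈ Set.Ioc 0 R, ∀ x d, HasDerivAt (fun x => W x t) d x → d = p x t)
    (hWq : ∀ x, ∀ t ∈ Set.Ioc 0 R, ∀ d, HasDerivAt (fun t => W x t) d t → d = q x t)
    (hac : ∀ x t, HasDerivAt (fun x => a x t) (c x t) x)
    (hbc : ∀ x t, HasDerivAt (fun t => b x t) (c x t) t)
    (ha0 : ∀ t, a (-R) t = 0) (ha1 : ∀ t, a R t = 0) (hb1 : ∀ x, b x R = 0) :
    ∫ t in (0:ℝ)..R, ∫ x in (-R)..R, (p x t * a x t - q x t * b x t)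
      = ∫ x in (-R)..R, W x 0 * b x 0 := by
  have hRR : -R ≤ R := by linarith
  obtain ⟨D, hD⟩ : ∃ D : ℝ, ∀ x ∈ Set.Icc (-R) R, ∀ t ∈ Set.Icc 0 R,
      |a x t| ≤ D ∧ |b x t| ≤ D ∧ |c x t| ≤ D := by
    have hK : IsCompact (Set.Icc (-R) R ×ˢ Set.Icc 0 R) := isCompact_Icc.prod isCompact_Icc
    obtain ⟨D1, h1⟩ := hK.exists_bound_of_continuousOn ha.continuousOn
    obtain ⟨D2, h2⟩ := hK.exists_bound_of_continuousOn hb.continuousOn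
    obtain ⟨D3, h3⟩ := hK.exists_bound_of_continuousOn hc.continuousOn
    refine ⟨max D1 (max D2 D3), fun x hx t ht => ?_⟩
    have hm : ((x, t) : ℝ × ℝ) ∈ Set.Icc (-R) R ×ˢ Set.Icc 0 R := ⟨hx, ht⟩
    exact ⟨(h1 _ hm).trans (le_max_left _ _),
      (h2 _ hm).trans ((le_max_left _ _).trans (le_max_right _ _)),
      (h3 _ hm).trans ((le_max_right _ _).trans (le_max_right _ _))⟩
  have mulb : ∀ {r s : ℝ}, |r| ≤ B → |s| ≤ D → |r * s| ≤ B * D := by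
    intro r s h1 h2
    rw [abs_mul]
    exact mul_le_mul h1 h2 (abs_nonneg _) ((abs_nonneg _).trans h1)
  have sw : Measurable (fun z : ℝ × ℝ => (z.2, z.1)) := measurable_swap
  have mpa : Measurable (fun z : ℝ × ℝ => p z.2 z.1 * a z.2 z.1) :=
    (hp.mul ha.measurable).comp sw
  have mqb : Measurable (fun z : ℝ × ℝ => q z.2 z.1 * b z.2 z.1) :=
    (hq.mul hb.measurable).comp sw
  have mWc : Measurable (fun z : ℝ × ℝ => W z.2 z.1 * c z.2 z.1) :=
    (hW.mul hc.measurable).comp sw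
  have bpa : ∀ t ∈ Set.Ioc 0 R, ∀ x ∈ Set.Ioc (-R) R, |p x t * a x t| ≤ B * D :=
    fun t ht x hx => mulb (hpB x (Set.Ioc_subset_Icc_self hx) t ht)
      (hD x (Set.Ioc_subset_Icc_self hx) t (Set.Ioc_subset_Icc_self ht)).1
  have bqb : ∀ t ∈ Set.Ioc 0 R, ∀ x ∈ Set.Ioc (-R) R, |q x t * b x t| ≤ B * D :=
    fun t ht x hx => mulb (hqB x (Set.Ioc_subset_Icc_self hx) t ht)
      (hD x (Set.Ioc_subset_Icc_self hx) t (Set.Ioc_subset_Icc_self ht)).2.1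
  have bWc : ∀ t ∈ Set.Ioc 0 R, ∀ x ∈ Set.Ioc (-R) R, |W x t * c x t| ≤ B * D :=
    fun t ht x hx => mulb
      (hWB x (Set.Ioc_subset_Icc_self hx) t (Set.Ioc_subset_Icc_self ht))
      (hD x (Set.Ioc_subset_Icc_self hx) t (Set.Ioc_subset_Icc_self ht)).2.2
  -- split
  have e1 : ∫ t in (0:ℝ)..R, ∫ x in (-R)..R, (p x t * a x t - q x t * b x t)
      = (∫ t in (0:ℝ)..R, ∫ x in (-R)..R, p x t * a x t)
        - ∫ t in (0:ℝ)..R, ∫ x in (-R)..R, q x t * b x t := by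
    rw [← intervalIntegral.integral_sub
      (aux_outer hR.le hRR (fun t x => p x t * a x t) mpa bpa)
      (aux_outer hR.le hRR (fun t x => q x t * b x t) mqb bqb)]
    apply intervalIntegral.integral_congr_ae
    refine Eventually.of_forall fun t ht => ?_
    rw [Set.uIoc_of_le hR.le] at ht
    exact intervalIntegral.integral_sub
      (aux_line hRR _ (mpa.comp (measurable_const.prodMk measurable_id)) (bpa t ht))
      (aux_line hRR _ (mqb.comp (measurable_const.prodMk measurable_id)) (bqb t ht))
  -- x part
  have e2 : ∫ t in (0:ℝ)..R, ∫ x in (-R)..R, p x t * a x t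
      = - ∫ t in (0:ℝ)..R, ∫ x in (-R)..R, W x t * c x t := by
    rw [← intervalIntegral.integral_neg]
    apply intervalIntegral.integral_congr_ae
    refine Eventually.of_forall fun t ht => ?_
    rw [Set.uIoc_of_le hR.le] at ht
    have := aux_ibp hRR (fun x => W x t) (fun x => p x t) (fun x => a x t) (fun x => c x t) K
      (fun x _ z _ => hWx t ht x z) (Eventually.of_forall fun x _ d hd => hWp t ht x d hd) (fun x => hac x t)
      (hc.comp (by fun_prop : Continuous fun x : ℝ => (x, t)))
    simp only [ha0, ha1] at this
    rw [this]; ring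
  have e3 : ∫ t in (0:ℝ)..R, ∫ x in (-R)..R, q x t * b x t
      = (- ∫ x in (-R)..R, W x 0 * b x 0) - ∫ t in (0:ℝ)..R, ∫ x in (-R)..R, W x t * c x t := by
    have s1 := intervalIntegral_intervalIntegral_swap (F := fun t x => q x t * b x t)
      (a := 0) (b := R) (c := -R) (d := R) (by
        have := aux_box hR.le hRR (fun t x => q x t * b x t) mqb bqb
        rwa [Measure.prod_restrict] at this)
    have s2 := intervalIntegral_intervalIntegral_swap (F := fun t x => W x t * c x t)
      (a := 0) (b := R) (c := -R) (d := R) (by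
        have := aux_box hR.le hRR (fun t x => W x t * c x t) mWc bWc
        rwa [Measure.prod_restrict] at this)
    rw [s1, s2,
      ← intervalIntegral.integral_neg, ← intervalIntegral.integral_sub]
    · apply intervalIntegral.integral_congr_ae
      refine Eventually.of_forall fun x hx => ?_
      have := aux_ibp hR.le (fun t => W x t) (fun t => q x t) (fun t => b x t)
        (fun t => c x t) K
        (fun t ht s hs => hWt x t ht s hs)
        (Eventually.of_forall fun t ht d hd => hWq x t (Set.Ioo_subset_Ioc_self ht) d hd) (fun t => hbc x t)
        (hc.comp (by fun_prop : Continuous fun t : ℝ => (x, t)))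
      simp only [hb1] at this
      rw [this]; ring
    · refine (aux_line (C := B * D) hRR (fun x => W x 0 * b x 0) ?_ ?_).neg
      · exact (hW.mul hb.measurable).comp (measurable_id.prodMk measurable_const)
      · intro x hx
        have h0 : (0:ℝ) ∈ Set.Icc 0 R := ⟨le_rfl, hR.le⟩
        exact mulb (hWB x (Set.Ioc_subset_Icc_self hx) 0 h0)
          (hD x (Set.Ioc_subset_Icc_self hx) 0 h0).2.1
    · exact aux_outer hRR hR.le (fun x t => W x t * c x t) (hW.mul hc.measurable)
        (fun x hx t ht => bWc t ht x hx)
  rw [e1, e2, e3]; ring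

lemma tau_pos {α t : ℝ} (hα : α ≠ 0) (ht : 0 < t) : 0 < tauChange α t := by
  unfold tauChange
  rcases lt_or_gt_of_ne hα with h | h
  · apply div_pos_of_neg_of_neg _ h
    have : 1 < Real.exp (-α * t) := Real.one_lt_exp_iff.2 (by nlinarith)
    linarith
  · apply div_pos _ h
    have : Real.exp (-α * t) < 1 := Real.exp_zero ▸ Real.exp_lt_exp.2 (by nlinarith)
    linarith

lemma tau_deriv {α : ℝ} (hα : α ≠ 0) (t : ℝ) :
    HasDerivAt (tauChange α) (Real.exp (-α * t)) t := by
  unfold tauChange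
  have h := ((((hasDerivAt_id t).const_mul (-α)).exp).const_sub 1).div_const α
  convert! h using 1
  simp; field_simp

/-- Velocity bound. -/
lemma aux_v {M x y τ : ℝ} {U : ℝ → ℝ} (hU : ∀ a b, |U a - U b| ≤ M * |a - b|) (hτ : 0 < τ)
    (h : (x - y) ^ 2 / (2 * τ) + U y ≤ (x - x) ^ 2 / (2 * τ) + U x) :
    |(x - y) / τ| ≤ 2 * M := by
  have h1 := (abs_le.1 (hU x y)).2
  have h2 : (x - y) ^ 2 / (2 * τ) ≤ M * |x - y| := by
    have : (x - x) ^ 2 / (2 * τ) = 0 := by simp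
    linarith
  rw [div_le_iff₀ (by positivity), ← sq_abs] at h2
  rw [abs_div, abs_of_pos hτ, div_le_iff₀ hτ]
  have hM : 0 ≤ M := by
    have := hU 1 0
    simp at this
    exact (abs_nonneg _).trans this
  rcases (abs_nonneg (x - y)).eq_or_lt with h0 | h0
  · rw [← h0]; positivity
  · nlinarith

/-- Comparison in `τ`. -/
lemma aux_tau {M x y z τ σ : ℝ} {U : ℝ → ℝ} (hU : ∀ a b, |U a - U b| ≤ M * |a - b|)
    (hτ : 0 < τ) (hσ : 0 < σ)
    (hv : |(x - y) / τ| ≤ 2 * M)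
    (h : (x - z) ^ 2 / (2 * σ) + U z ≤
      (x - (x - (x - y) / τ * σ)) ^ 2 / (2 * σ) + U (x - (x - y) / τ * σ)) :
    (x - z) ^ 2 / (2 * σ) + U z - ((x - y) ^ 2 / (2 * τ) + U y) ≤ 4 * M ^ 2 * |σ - τ| := by
  have hM : 0 ≤ M := by
    have := hU 1 0
    simp at this
    exact (abs_nonneg _).trans this
  set v := (x - y) / τ with hvd
  have hy : x - y = v * τ := by rw [hvd]; field_simp
  have h1 : (x - (x - v * σ)) ^ 2 / (2 * σ) = v ^ 2 / 2 * σ := by field_simp; ring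
  have h2 : (x - y) ^ 2 / (2 * τ) = v ^ 2 / 2 * τ := by rw [hy]; field_simp
  have h3 := (abs_le.1 (hU (x - v * σ) y)).2
  have h4 : x - v * σ - y = v * (τ - σ) := by linarith
  rw [h4, abs_mul, abs_sub_comm τ σ] at h3
  have h5 : v ^ 2 ≤ 4 * M ^ 2 := by
    rw [← sq_abs]; nlinarith [abs_nonneg v]
  have h6 : M * (|v| * |σ - τ|) ≤ M * (2 * M * |σ - τ|) := by gcongr
  have h7 : v ^ 2 / 2 * (σ - τ) ≤ 2 * M ^ 2 * |σ - τ| := by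
    calc v ^ 2 / 2 * (σ - τ) ≤ v ^ 2 / 2 * |σ - τ| := by gcongr; exact le_abs_self _
      _ ≤ _ := by gcongr; linarith
  rw [h1] at h
  rw [h2]
  nlinarith

/-- Envelope principle. -/
lemma aux_env {f g : ℝ → ℝ} {x d e : ℝ} (hle : ∀ᶠ z in nhds x, f z ≤ g z) (hx : f x = g x)
    (hf : HasDerivAt f d x) (hg : HasDerivAt g e x) : d = e := by
  have hmin : IsLocalMin (fun z => g z - f z) x := by
    filter_upwards [hle] with z hz
    simp only [hx, sub_self]
    linarith
  have := hmin.hasDerivAt_eq_zero (hg.sub hf)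
  linarith

lemma aux_test (α : ℝ) (φ : ℝ × ℝ → ℝ) (hφ : ContDiff ℝ (⊤ : ℕ∞) φ) (hs : HasCompactSupport φ) :
    ∃ (R : ℝ) (a b c : ℝ → ℝ → ℝ), 0 < R ∧
      Continuous (fun z : ℝ × ℝ => a z.1 z.2) ∧ Continuous (fun z : ℝ × ℝ => b z.1 z.2) ∧
      Continuous (fun z : ℝ × ℝ => c z.1 z.2) ∧
      (∀ x t, HasDerivAt (fun x => a x t) (c x t) x) ∧
      (∀ x t, HasDerivAt (fun t => b x t) (c x t) t) ∧
      (∀ x t, R ≤ |x| ∨ R ≤ |t| → a x t = 0 ∧ b x t = 0 ∧ φ (x, t) = 0) ∧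
      (∀ x t, a x t = Real.exp (-α * t) * (deriv (fun s => φ (x, s)) t - α * φ (x, t))) ∧
      (∀ x t, b x t = Real.exp (-α * t) * deriv (fun x' => φ (x', t)) x) ∧
      (∀ x, HasDerivAt (fun x => φ (x, 0)) (b x 0) x) := by
  obtain ⟨R, hR⟩ := hs.isCompact.isBounded.subset_ball (0 : ℝ × ℝ)
  have hout : ∀ x t, max R 1 ≤ |x| ∨ max R 1 ≤ |t| → (x, t) ∉ tsupport φ := by
    intro x t h hmem
    have h1 := hR hmem
    rw [mem_ball_zero_iff, Prod.norm_def, max_lt_iff] at h1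
    simp only [Real.norm_eq_abs] at h1
    rcases h with h | h
    · exact absurd (lt_of_lt_of_le h1.1 (le_max_left R 1)) (not_lt.2 h)
    · exact absurd (lt_of_lt_of_le h1.2 (le_max_left R 1)) (not_lt.2 h)
  set ψ : ℝ × ℝ → ℝ := fun z => Real.exp (-α * z.2) * φ z with hψ
  have hψc : ContDiff ℝ (⊤ : ℕ∞) ψ := by
    apply ContDiff.mul _ hφ
    fun_prop
  have hψs : tsupport ψ ⊆ tsupport φ := tsupport_mul_subset_right
  have hψd : ∀ z, HasFDerivAt ψ (fderiv ℝ ψ z) z := fun z =>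
    (hψc.differentiable (by simp) z).hasFDerivAt
  have hφd : ∀ z, HasFDerivAt φ (fderiv ℝ φ z) z := fun z =>
    (hφ.differentiable (by simp) z).hasFDerivAt
  have hψ1 : ContDiff ℝ (⊤ : ℕ∞) (fderiv ℝ ψ) := hψc.fderiv_right (by simp)
  have hψd2 : ∀ z, HasFDerivAt (fderiv ℝ ψ) (fderiv ℝ (fderiv ℝ ψ) z) z := fun z =>
    (hψ1.differentiable (by simp) z).hasFDerivAt
  have hψ2 : Continuous (fderiv ℝ (fderiv ℝ ψ)) := hψ1.continuous_fderiv (by simp)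
  have lx : ∀ x t : ℝ, HasDerivAt (fun x : ℝ => (x, t)) ((1 : ℝ), (0 : ℝ)) x := fun x t =>
    (hasDerivAt_id x).prodMk (hasDerivAt_const x t)
  have lt : ∀ x t : ℝ, HasDerivAt (fun t : ℝ => (x, t)) ((0 : ℝ), (1 : ℝ)) t := fun x t =>
    (hasDerivAt_const t x).prodMk (hasDerivAt_id t)
  have hex : ∀ t : ℝ, HasDerivAt (fun t => Real.exp (-α * t)) (Real.exp (-α * t) * (-α)) t := by
    intro t
    have := ((hasDerivAt_id t).const_mul (-α)).exp
    simpa using this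
  have hbx : ∀ x t, HasDerivAt (fun x => ψ (x, t)) (fderiv ℝ ψ (x, t) (1, 0)) x :=
    fun x t => by
      have h := (hψd (x, t)).comp_hasDerivAt x (lx x t)
      exact h
  refine ⟨max R 1, fun x t => fderiv ℝ ψ (x, t) (0, 1), fun x t => fderiv ℝ ψ (x, t) (1, 0),
    fun x t => fderiv ℝ (fderiv ℝ ψ) (x, t) (1, 0) (0, 1), by positivity, ?_, ?_, ?_, ?_, ?_, ?_,
    ?_, ?_, ?_⟩
  · exact hψ1.continuous.clm_apply continuous_const
  · exact hψ1.continuous.clm_apply continuous_const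
  · exact (hψ2.clm_apply continuous_const).clm_apply continuous_const
  · intro x t
    have := (hψd2 (x, t)).comp_hasDerivAt x (lx x t)
    have h2 := this.clm_apply (hasDerivAt_const x ((0 : ℝ), (1 : ℝ)))
    simpa using h2
  · intro x t
    have := (hψd2 (x, t)).comp_hasDerivAt t (lt x t)
    have h2 := this.clm_apply (hasDerivAt_const t ((1 : ℝ), (0 : ℝ)))
    have hsym : IsSymmSndFDerivAt ℝ ψ (x, t) :=
      hψc.contDiffAt.isSymmSndFDerivAt (by
        rw [minSmoothness_of_isRCLikeNormedField]
        exact WithTop.coe_le_coe.2 le_top)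
    simp only []
    rw [hsym.eq (1, 0) (0, 1)]
    simpa using h2
  · intro x t h
    have h1 := hout x t h
    have h2 : fderiv ℝ ψ (x, t) = 0 := by
      by_contra hne
      exact h1 (hψs (support_fderiv_subset ℝ hne))
    refine ⟨by simp only [h2]; rfl, by simp only [h2]; rfl, image_eq_zero_of_notMem_tsupport h1⟩
  · intro x t
    have h1 : HasDerivAt (fun s => ψ (x, s)) (fderiv ℝ ψ (x, t) (0, 1)) t :=
      (hψd (x, t)).comp_hasDerivAt t (lt x t)
    have h0 : HasDerivAt (fun s => φ (x, s)) (fderiv ℝ φ (x, t) (0, 1)) t :=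
      (hφd (x, t)).comp_hasDerivAt t (lt x t)
    have h2 := (hex t).mul h0
    rw [h0.deriv]
    have := h1.unique h2
    simp only [this]; ring
  · intro x t
    have h0 : HasDerivAt (fun x => φ (x, t)) (fderiv ℝ φ (x, t) (1, 0)) x :=
      (hφd (x, t)).comp_hasDerivAt x (lx x t)
    rw [h0.deriv]
    exact (hbx x t).unique (h0.const_mul (Real.exp (-α * t)))
  · intro x
    have := hbx x 0
    simpa [hψ] using this

/-- **the vanishing viscosity limit is a distributional solution.**
If `y(x, t)` is a measurable selection of global minimizers of `z ↦ θ(x, z, τ(t))` and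
`u(x, t) = e^{-αt}(x - y(x,t))/τ(t)`, then `u` is a distributional solution of
`u_t + (u²/2)_x + αu = 0` with initial data `u0`. -/
theorem vanishing_viscosity_limit_is_distributional_solution
    (α : ℝ) (hα : α ≠ 0) (u0 : ℝ → ℝ) (hu0m : Measurable u0)
    (M : ℝ) (hu0b : ∀ x, |u0 x| ≤ M)
    (y : ℝ → ℝ → ℝ) (hym : Measurable (fun p : ℝ × ℝ => y p.1 p.2))
    (hmin : ∀ x t, 0 < t →
      ∀ z : ℝ, thetaFn u0 x (y x t) (tauChange α t) ≤ thetaFn u0 x z (tauChange α t))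
    (u : ℝ → ℝ → ℝ)
    (hu : ∀ x t, u x t = Real.exp (-α * t) * (x - y x t) / tauChange α t) :
    ∀ φ : ℝ × ℝ → ℝ, ContDiff ℝ (⊤ : ℕ∞) φ → HasCompactSupport φ →
      (∫ t in Set.Ioi (0:ℝ), ∫ x : ℝ,
          (u x t * deriv (fun s => φ (x, s)) t
            + (u x t) ^ 2 / 2 * deriv (fun x' => φ (x', t)) x
            - α * u x t * φ (x, t)))
        + (∫ x : ℝ, u0 x * φ (x, 0)) = 0 := by
  intro φ hφ hs
  obtain ⟨R, a, b, c, hR, ha, hb, hc, hac, hbc, hout, haφ, hbφ, hφ0⟩ := aux_test α φ hφ hs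
  have hRR : -R ≤ R := by linarith
  -- the primitive of the initial datum
  have hloc : LocallyIntegrable u0 volume := by
    intro x
    refine ⟨Set.Icc (x - 1) (x + 1), Icc_mem_nhds (by linarith) (by linarith), ?_⟩
    exact Measure.integrableOn_of_bounded (M := M) (by simp) hu0m.aestronglyMeasurable
      (Eventually.of_forall fun x => by rw [Real.norm_eq_abs]; exact hu0b x)
  have hii : ∀ r s, IntervalIntegrable u0 volume r s := fun r s =>
    intervalIntegrable_iff.2
      ((hloc.integrableOn_isCompact isCompact_uIcc).mono_set Set.uIoc_subset_uIcc)
  set U : ℝ → ℝ := fun z => ∫ s in (0:ℝ)..z, u0 s with hUdef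
  have hU : ∀ r s, |U r - U s| ≤ M * |r - s| := by
    intro r s
    rw [hUdef]
    simp only []
    rw [intervalIntegral.integral_interval_sub_left (hii _ _) (hii _ _)]
    exact intervalIntegral.norm_integral_le_of_norm_le_const (f := u0) (C := M)
      (fun x _ => hu0b x)
  have hM : 0 ≤ M := (abs_nonneg _).trans (hu0b 0)
  have hU0 : U 0 = 0 := by simp [hUdef]
  have hUc : Continuous U := by
    refine LipschitzWith.continuous (K := M.toNNReal) (LipschitzWith.of_dist_le_mul ?_)
    intro r s
    rw [Real.dist_eq, Real.dist_eq, Real.coe_toNNReal M hM]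
    exact hU r s
  have hth : ∀ x z τ, thetaFn u0 x z τ = (x - z) ^ 2 / (2 * τ) + U z := fun _ _ _ => rfl
  simp only [hth] at hmin
  have hτ : ∀ {t : ℝ}, 0 < t → 0 < tauChange α t := fun ht => tau_pos hα ht
  have hτ0 : tauChange α 0 = 0 := by simp [tauChange]
  have hτc : Continuous (tauChange α) := by unfold tauChange; fun_prop
  have hv : ∀ x t, 0 < t → |(x - y x t) / tauChange α t| ≤ 2 * M := fun x t ht =>
    aux_v hU (hτ ht) (hmin x t ht x)
  -- the value function
  set W : ℝ → ℝ → ℝ := fun x t =>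
    if 0 < t then (x - y x t) ^ 2 / (2 * tauChange α t) + U (y x t) else U x with hWdef
  have hWpos : ∀ x {t}, 0 < t →
      W x t = (x - y x t) ^ 2 / (2 * tauChange α t) + U (y x t) := by
    intro x t ht; simp [hWdef, ht]
  have hWz : ∀ x, W x 0 = U x := by intro x; simp [hWdef]
  have hWle : ∀ x {t} z, 0 < t → W x t ≤ (x - z) ^ 2 / (2 * tauChange α t) + U z := by
    intro x t z ht; rw [hWpos x ht]; exact hmin x t ht z
  have hWxle : ∀ t, 0 < t → ∀ x z, W x t - W z t ≤ M * |x - z| := by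
    intro t ht x z
    have h1 := hWle x (y z t + (x - z)) ht
    rw [hWpos z ht]
    have h2 := (abs_le.1 (hU (y z t + (x - z)) (y z t))).2
    have h3 : x - (y z t + (x - z)) = z - y z t := by ring
    have h4 : y z t + (x - z) - y z t = x - z := by ring
    rw [h3] at h1
    rw [h4] at h2
    linarith
  have hWx : ∀ t, 0 < t → ∀ x z, |W x t - W z t| ≤ M * |x - z| := by
    intro t ht x z
    rw [abs_le]
    have h1 := hWxle t ht x z
    have h2 := hWxle t ht z x
    rw [abs_sub_comm] at h2
    constructor <;> linarith
  have hWτle : ∀ x t s, 0 < t → 0 < s →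
      W x s - W x t ≤ 4 * M ^ 2 * |tauChange α s - tauChange α t| := by
    intro x t s ht hs
    rw [hWpos x ht, hWpos x hs]
    exact aux_tau hU (hτ ht) (hτ hs) (hv x t ht) (hmin x s hs _)
  have hW0 : ∀ x t, 0 < t → |W x t - W x 0| ≤ 4 * M ^ 2 * |tauChange α t| := by
    intro x t ht
    rw [hWz, abs_of_pos (hτ ht), abs_le]
    have hp := hτ ht
    have h1 := hWle x x ht
    have h2 : (x - x) ^ 2 / (2 * tauChange α t) = 0 := by simp
    have h3 := (abs_le.1 (hU x (y x t))).2
    have h4 := hv x t ht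
    rw [abs_div, abs_of_pos hp, div_le_iff₀ hp] at h4
    have h5 : 0 ≤ (x - y x t) ^ 2 / (2 * tauChange α t) := by positivity
    have h6 : M * |x - y x t| ≤ M * (2 * M * tauChange α t) := by gcongr
    have h7 : 0 ≤ M ^ 2 * tauChange α t := by positivity
    have h8 := hWpos x ht
    constructor <;> nlinarith
  have hWτ : ∀ x t s, 0 ≤ t → 0 ≤ s →
      |W x t - W x s| ≤ 4 * M ^ 2 * |tauChange α t - tauChange α s| := by
    intro x t s ht hs
    rcases ht.eq_or_lt with rfl | ht
    · rcases hs.eq_or_lt with rfl | hs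
      · simp
      · rw [hτ0, abs_sub_comm, abs_sub_comm 0, sub_zero]
        exact hW0 x s hs
    · rcases hs.eq_or_lt with rfl | hs
      · rw [hτ0, sub_zero]
        exact hW0 x t ht
      · rw [abs_le]
        have h1 := hWτle x t s ht hs
        have h2 := hWτle x s t hs ht
        rw [abs_sub_comm] at h1
        constructor <;> linarith
  obtain ⟨L, hL⟩ : ∃ L : ℝ, 0 ≤ L ∧ ∀ t ∈ Set.Icc 0 R, ∀ s ∈ Set.Icc 0 R,
      |tauChange α t - tauChange α s| ≤ L * |t - s| := by
    have hcd : ContDiff ℝ 1 (tauChange α) := by unfold tauChange; fun_prop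
    obtain ⟨L, hL⟩ := hcd.contDiffOn.exists_lipschitzOnWith (s := Set.Icc 0 R) (by decide)
      (convex_Icc _ _) isCompact_Icc
    refine ⟨L, L.2, fun t ht s hs => ?_⟩
    have := hL.dist_le_mul t ht s hs
    rwa [Real.dist_eq, Real.dist_eq] at this
  obtain ⟨hL0, hL⟩ := hL
  set v : ℝ → ℝ → ℝ := fun x t => (x - y x t) / tauChange α t with hvdef
  have hvm : Measurable (fun z : ℝ × ℝ => v z.1 z.2) :=
    (measurable_fst.sub hym).div (hτc.measurable.comp measurable_snd)
  have hWm : Measurable (fun z : ℝ × ℝ => W z.1 z.2) := by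
    refine Measurable.ite (measurableSet_lt measurable_const measurable_snd) ?_ ?_
    · exact (((measurable_fst.sub hym).pow_const 2).div
        ((hτc.measurable.comp measurable_snd).const_mul 2)).add (hUc.measurable.comp hym)
    · exact hUc.measurable.comp measurable_fst
  set q : ℝ → ℝ → ℝ := fun x t => -(Real.exp (-α * t) * (v x t) ^ 2 / 2) with hqdef
  have hqm : Measurable (fun z : ℝ × ℝ => q z.1 z.2) := by
    have : Measurable (fun z : ℝ × ℝ => Real.exp (-α * z.2)) := by fun_prop
    exact ((this.mul (hvm.pow_const 2)).div_const 2).neg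
  obtain ⟨E, hE⟩ : ∃ E : ℝ, ∀ t ∈ Set.Icc 0 R, |Real.exp (-α * t)| ≤ E := by
    obtain ⟨E, hE⟩ := (isCompact_Icc (a := (0:ℝ)) (b := R)).exists_bound_of_continuousOn
      (f := fun t => Real.exp (-α * t)) (by fun_prop)
    exact ⟨E, hE⟩
  have hE0 : 0 ≤ E := (abs_nonneg _).trans (hE 0 ⟨le_rfl, hR.le⟩)
  have hBW : ∀ x ∈ Set.Icc (-R) R, ∀ t ∈ Set.Icc 0 R,
      |W x t| ≤ M * R + 4 * M ^ 2 * (L * R) := by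
    intro x hx t ht
    have h0 : (0:ℝ) ∈ Set.Icc 0 R := ⟨le_rfl, hR.le⟩
    have h1 := hWτ x t 0 ht.1 le_rfl
    have h2 := hL t ht 0 h0
    have h3 := hU x 0
    rw [hWz] at h1
    rw [hU0, sub_zero, sub_zero] at h3
    rw [sub_zero, abs_of_nonneg ht.1] at h2
    have h4 : L * t ≤ L * R := by gcongr; exact ht.2
    have h5 : 4 * M ^ 2 * |tauChange α t - tauChange α 0| ≤ 4 * M ^ 2 * (L * R) := by
      gcongr; linarith
    have h6 : M * |x| ≤ M * R := by gcongr; exact abs_le.2 hx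
    have h7 : |W x t| ≤ |W x t - U x| + |U x| := by
      have := abs_add_le (W x t - U x) (U x)
      simpa using this
    linarith
  have hBq : ∀ x ∈ Set.Icc (-R) R, ∀ t ∈ Set.Ioc 0 R, |q x t| ≤ E * (2 * M) ^ 2 / 2 := by
    intro x _ t ht
    have h1 := hv x t ht.1
    have h2 := hE t (Set.Ioc_subset_Icc_self ht)
    simp only [hqdef]
    rw [abs_neg, abs_div, abs_mul, abs_pow, abs_two]
    gcongr
  have hcore := aux_core hR W v q a b c (max M (4 * M ^ 2 * L))
    (max (M * R + 4 * M ^ 2 * (L * R)) (max (2 * M) (E * (2 * M) ^ 2 / 2)))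
    hWm hvm hqm ha hb hc
    (fun x hx t ht => (hBW x hx t ht).trans (le_max_left _ _))
    (fun x hx t ht => (hv x t ht.1).trans ((le_max_left _ _).trans (le_max_right _ _)))
    (fun x hx t ht => (hBq x hx t ht).trans ((le_max_right _ _).trans (le_max_right _ _)))
    (fun t ht x z => (hWx t ht.1 x z).trans (by gcongr; exact le_max_left _ _))
    (by
      intro x t ht s hs
      refine (hWτ x t s ht.1 hs.1).trans ?_
      calc 4 * M ^ 2 * |tauChange α t - tauChange α s| ≤ 4 * M ^ 2 * (L * |t - s|) := by
            gcongr; exact hL t ht s hs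
        _ = (4 * M ^ 2 * L) * |t - s| := by ring
        _ ≤ _ := by gcongr; exact le_max_right _ _)
    (by
      intro t ht x d hd
      have hg : HasDerivAt (fun z => (z - y x t) ^ 2 / (2 * tauChange α t) + U (y x t))
          (v x t) x := by
        have h := ((((hasDerivAt_id x).sub_const (y x t)).pow 2).div_const
          (2 * tauChange α t)).add_const (U (y x t))
        have hp := (hτ ht.1).ne'
        convert! h using 1
        simp only [hvdef, id]
        field_simp
        norm_num
        ring
      exact aux_env (Eventually.of_forall fun z => hWle z (y x t) ht.1) (hWpos x ht.1) hd hg)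
    (by
      intro x t ht d hd
      have hp := (hτ ht.1).ne'
      have hg : HasDerivAt (fun s => (x - y x t) ^ 2 / (2 * tauChange α s) + U (y x t))
          (q x t) t := by
        have h := (((hasDerivAt_const t ((x - y x t) ^ 2)).div
          ((tau_deriv hα t).const_mul 2) (by positivity))).add_const (U (y x t))
        convert! h using 1
        simp only [hqdef, hvdef]
        field_simp
        ring
      refine aux_env ?_ (hWpos x ht.1) hd hg
      filter_upwards [lt_mem_nhds ht.1] with s hs
      exact hWle x (y x t) hs)
    hac hbc
    (fun t => (hout (-R) t (Or.inl (by rw [abs_neg]; exact le_abs_self R))).1)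
    (fun t => (hout R t (Or.inl (le_abs_self R))).1)
    (fun x => (hout x R (Or.inr (le_abs_self R))).2.1)
  -- rewrite the integrals
  have hint : ∀ x t, u x t * deriv (fun s => φ (x, s)) t
            + (u x t) ^ 2 / 2 * deriv (fun x' => φ (x', t)) x
            - α * u x t * φ (x, t) = v x t * a x t - q x t * b x t := by
    intro x t
    have h1 : u x t = Real.exp (-α * t) * v x t := by rw [hu, hvdef]; ring
    rw [haφ, hbφ, h1, hqdef]; ring
  have hbig : ∀ x, x ∉ Set.Ioc (-R) R → R ≤ |x| := by
    intro x hx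
    by_contra hlt
    rw [not_le, abs_lt] at hlt
    exact hx ⟨hlt.1, hlt.2.le⟩
  have hinner : ∀ t, (∫ x : ℝ, (v x t * a x t - q x t * b x t))
      = ∫ x in (-R)..R, (v x t * a x t - q x t * b x t) := by
    intro t
    rw [intervalIntegral.integral_of_le hRR]
    refine (setIntegral_eq_integral_of_forall_compl_eq_zero fun x hx => ?_).symm
    have := hout x t (Or.inl (hbig x hx))
    rw [this.1, this.2.1]; ring
  have hfirst : (∫ t in Set.Ioi (0:ℝ), ∫ x : ℝ, (v x t * a x t - q x t * b x t))
      = ∫ t in (0:ℝ)..R, ∫ x in (-R)..R, (v x t * a x t - q x t * b x t) := by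
    simp only [hinner]
    rw [intervalIntegral.integral_of_le hR.le]
    refine setIntegral_eq_of_subset_of_forall_sdiff_eq_zero measurableSet_Ioi
      Set.Ioc_subset_Ioi_self ?_
    intro t ht
    have hRt : R ≤ |t| := by
      have h1 : 0 < t := ht.1
      have h2 : R < t := by
        by_contra hcon
        exact ht.2 ⟨h1, not_lt.1 hcon⟩
      exact h2.le.trans (le_abs_self t)
    have hz : ∀ x, v x t * a x t - q x t * b x t = 0 := by
      intro x
      have := hout x t (Or.inr hRt)
      rw [this.1, this.2.1]; ring
    simp [hz]
  have hlast : (∫ x : ℝ, u0 x * φ (x, 0)) = ∫ x in (-R)..R, u0 x * φ (x, 0) := by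
    rw [intervalIntegral.integral_of_le hRR]
    refine (setIntegral_eq_integral_of_forall_compl_eq_zero fun x hx => ?_).symm
    have := hout x 0 (Or.inl (hbig x hx))
    rw [this.2.2]; ring
  have hibp := aux_ibp hRR U u0 (fun x => φ (x, 0)) (fun x => b x 0) M
    (fun x _ z _ => hU x z)
    (by
      filter_upwards [LocallyIntegrable.ae_hasDerivAt_integral hloc] with x hx _ d hd
      exact hd.unique (hx 0))
    hφ0 (hb.comp (by fun_prop : Continuous fun x : ℝ => (x, (0:ℝ))))
  have hp1 : φ (R, 0) = 0 := (hout R 0 (Or.inl (le_abs_self R))).2.2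
  have hp2 : φ (-R, 0) = 0 :=
    (hout (-R) 0 (Or.inl (by rw [abs_neg]; exact le_abs_self R))).2.2
  simp only [hp1, hp2] at hibp
  simp only [hWz] at hcore
  simp only [hint]
  rw [hfirst, hcore, hlast, hibp]
  ring
end

section
/- Let α ≠ 0 be a real constant, u0 ∈ L^∞(ℝ) measurable, and fix t > 0. Let y : ℝ → ℝ be any function such that for every x ∈ ℝ, y(x) is a global minimizer of z ↦ θ(x, z, τ(t)), and set u(x) = e^{−αt} (x − y(x))/τ(t). Then y is nondecreasing, the one-sided limits u(x₀+) = lim_{x → x₀⁺} u(x) and u(x₀−) = lim_{x → x₀⁻} u(x) exist at every x₀ ∈ ℝ, and the Lax entropy condition u(x₀+) ≤ u(x₀−) holds at every x₀ ∈ ℝ. -/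
open Real Filter MeasureTheory

/-- **Lax entropy condition.**
For fixed `t > 0`, if `y(x)` is a global minimizer of `z ↦ θ(x, z, τ(t))` for every `x`,
and `u(x) = e^{-αt}(x - y(x))/τ(t)`, then `y` is nondecreasing, the one-sided limits
`u(x₀±)` exist at every `x₀`, and `u(x₀+) ≤ u(x₀-)`. -/
theorem entropy_condition_of_vanishing_viscosity_limit
    (α : ℝ) (hα : α ≠ 0) (u0 : ℝ → ℝ) (hu0m : Measurable u0)
    (M : ℝ) (hu0b : ∀ x, |u0 x| ≤ M)
    (t : ℝ) (ht : 0 < t) (y : ℝ → ℝ)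
    (hmin : ∀ x z : ℝ, thetaFn u0 x (y x) (tauChange α t) ≤ thetaFn u0 x z (tauChange α t))
    (u : ℝ → ℝ)
    (hu : ∀ x, u x = Real.exp (-α * t) * (x - y x) / tauChange α t) :
    Monotone y ∧
      ∀ x₀ : ℝ, ∃ L R : ℝ,
        Tendsto u (nhdsWithin x₀ (Set.Iio x₀)) (nhds L) ∧
        Tendsto u (nhdsWithin x₀ (Set.Ioi x₀)) (nhds R) ∧
        R ≤ L := by
  have hτ : 0 < tauChange α t := by
    unfold tauChange
    rcases lt_or_gt_of_ne hα with h | h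
    · apply div_pos_of_neg_of_neg _ h
      have : 1 < Real.exp (-α * t) := Real.one_lt_exp_iff.mpr (mul_pos (by linarith) ht)
      linarith
    · apply div_pos _ h
      have : Real.exp (-α * t) < 1 := Real.exp_lt_one_iff.mpr (by nlinarith [mul_pos h ht])
      linarith
  generalize tauChange α t = τ at *
  have hy : Monotone y := by
    intro a b hab
    rcases hab.eq_or_lt with rfl | hlt
    · exact le_rfl
    have h1 := hmin a (y b)
    have h2 := hmin b (y a)
    unfold thetaFn at h1 h2
    have h3 : (a - y a) ^ 2 / (2 * τ) + (b - y b) ^ 2 / (2 * τ)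
        ≤ (a - y b) ^ 2 / (2 * τ) + (b - y a) ^ 2 / (2 * τ) := by linarith
    rw [← add_div, ← add_div, div_le_div_iff_of_pos_right (by linarith)] at h3
    by_contra hc
    push Not at hc
    nlinarith [mul_pos (sub_pos.2 hlt) (sub_pos.2 hc)]
  refine ⟨hy, fun x₀ => ?_⟩
  have hu' : u = fun x => Real.exp (-α * t) * (x - y x) / τ := funext hu
  have hid : ∀ s : Set ℝ, Tendsto (fun x : ℝ => x) (nhdsWithin x₀ s) (nhds x₀) :=
    fun s => tendsto_id.mono_left nhdsWithin_le_nhds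
  refine ⟨Real.exp (-α * t) * (x₀ - Function.leftLim y x₀) / τ,
    Real.exp (-α * t) * (x₀ - Function.rightLim y x₀) / τ, ?_, ?_, ?_⟩
  · rw [hu']
    exact (((hid _).sub (hy.tendsto_leftLim x₀)).const_mul _).div_const _
  · rw [hu']
    exact (((hid _).sub (hy.tendsto_rightLim x₀)).const_mul _).div_const _
  · have := hy.leftLim_le_rightLim (le_refl x₀)
    gcongr
end
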